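/- arXiv:2207.01673 — 10 statements merged into one kernel-verified Lean document; each statement's English description precedes it below -/
import Mathlib

section
/- Let P and Q be orthogonal projections on ℂ^m (complex m×m matrices with P = P* = P² and Q = Q* = Q²) and let U = (2P − I)(2Q − I). Then the 1-eigenspace of U decomposes as ker(U − I) = (range P ∩ range Q) ⊕ (ker P ∩ ker Q) (the two summands intersect trivially and their sum is ker(U − I)), and consequently dim ker(U − I) = m − rank P − rank Q + 2·dim(range P ∩ range Q). -/
open Matrix

/-- The common kernel of two Hermitian matrices has dimension complementary to the sum of
their ranges. -/
theorem Matrix.IsHermitian.finrank_ker_inf_ker_add_finrank_range_sup_range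
    {n : Type*} [Fintype n] {A B : Matrix n n ℂ} (hA : A.IsHermitian) (hB : B.IsHermitian) :
    Module.finrank ℂ ↥(LinearMap.ker A.mulVecLin ⊓ LinearMap.ker B.mulVecLin) +
      Module.finrank ℂ ↥(LinearMap.range A.mulVecLin ⊔ LinearMap.range B.mulVecLin) =
        Fintype.card n := by
  have hker : LinearMap.ker (fromRows A B).mulVecLin =
      LinearMap.ker A.mulVecLin ⊓ LinearMap.ker B.mulVecLin := by
    ext x
    simp only [LinearMap.mem_ker, Submodule.mem_inf, mulVecLin_apply, fromRows_mulVec,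
      funext_iff, Sum.forall, Sum.elim_inl, Sum.elim_inr, Pi.zero_apply]
  have hrange : LinearMap.range (fromCols A B).mulVecLin =
      LinearMap.range A.mulVecLin ⊔ LinearMap.range B.mulVecLin := by
    ext x
    simp only [LinearMap.mem_range, Submodule.mem_sup, mulVecLin_apply, fromCols_mulVec]
    constructor
    · rintro ⟨y, rfl⟩
      exact ⟨_, ⟨_, rfl⟩, _, ⟨_, rfl⟩, rfl⟩
    · rintro ⟨_, ⟨y, rfl⟩, _, ⟨z, rfl⟩, rfl⟩
      exact ⟨Sum.elim y z, by simp⟩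
  have hrank : (fromCols A B).rank = (fromRows A B).rank := by
    open ComplexOrder in
    rw [← rank_conjTranspose, conjTranspose_fromCols_eq_fromRows_conjTranspose, hA.eq, hB.eq]
  have h := LinearMap.finrank_range_add_finrank_ker (fromRows A B).mulVecLin
  rw [Module.finrank_fintype_fun_eq_card, hker] at h
  rw [← hrange, ← h, add_comm]
  exact congrArg (· + _) hrank

/-- An idempotent matrix fixes exactly the vectors in its range. -/
theorem Matrix.mem_range_mulVecLin_iff_of_mul_self {n R : Type*} [Fintype n] [CommSemiring R]
    {A : Matrix n n R} (hA : A * A = A) {x : n → R} :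
    x ∈ LinearMap.range A.mulVecLin ↔ A *ᵥ x = x := by
  constructor
  · rintro ⟨y, rfl⟩
    simp [mulVec_mulVec, hA]
  · exact fun h => ⟨x, h⟩

/-- A vector is fixed by the product of the reflections of two idempotents if and only if the
idempotents agree on it. -/
theorem Matrix.mem_ker_reflection_mul_reflection_sub_one_iff {n : Type*} [Fintype n]
    [DecidableEq n] {P Q : Matrix n n ℂ} (hP : P * P = P) {x : n → ℂ} :
    x ∈ LinearMap.ker (((2 : ℂ) • P - 1) * ((2 : ℂ) • Q - 1) - 1).mulVecLin ↔
      P *ᵥ x = Q *ᵥ x := by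
  have hinv : ((2 : ℂ) • P - 1) * ((2 : ℂ) • P - 1) = 1 := by
    simp only [sub_mul, mul_sub, smul_mul_smul_comm, hP, mul_one, one_mul]
    module
  have hdiff : ((2 : ℂ) • Q - 1) - ((2 : ℂ) • P - 1) = (2 : ℂ) • (Q - P) := by module
  have hfactor : ((2 : ℂ) • P - 1) * ((2 : ℂ) • Q - 1) - 1 =
      ((2 : ℂ) • P - 1) * ((2 : ℂ) • (Q - P)) := by
    rw [← hdiff, mul_sub _ ((2 : ℂ) • Q - 1) ((2 : ℂ) • P - 1), hinv]
  rw [LinearMap.mem_ker, mulVecLin_apply, hfactor, ← mulVec_mulVec]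
  constructor
  · intro h
    have h2 := congrArg (((2 : ℂ) • P - 1) *ᵥ ·) h
    rw [mulVec_mulVec, hinv, one_mulVec, mulVec_zero, smul_mulVec, sub_mulVec,
      smul_eq_zero_iff_right two_ne_zero] at h2
    exact (sub_eq_zero.mp h2).symm
  · intro h
    rw [smul_mulVec 2 (Q - P), sub_mulVec Q, h, sub_self, smul_zero, mulVec_zero]

/-- For orthogonal projections `P, Q` on `ℂ^m` and
`U = (2P − I)(2Q − I)`, the `1`-eigenspace of `U` decomposes as
`ker(U − I) = (range P ∩ range Q) ⊕ (ker P ∩ ker Q)`, and consequently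
`dim ker(U − I) + rank P + rank Q = m + 2 · dim(range P ∩ range Q)`
(the dimension formula
`dim ker(U − I) = m − rank P − rank Q + 2 · dim(range P ∩ range Q)`). -/
theorem one_eigenspace_of_product_of_reflections
    (m : ℕ) (P Q U : Matrix (Fin m) (Fin m) ℂ)
    (hP : P.IsHermitian) (hP2 : P * P = P)
    (hQ : Q.IsHermitian) (hQ2 : Q * Q = Q)
    (hU : U = ((2 : ℂ) • P - 1) * ((2 : ℂ) • Q - 1)) :
    ((LinearMap.range P.mulVecLin ⊓ LinearMap.range Q.mulVecLin) ⊓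
        (LinearMap.ker P.mulVecLin ⊓ LinearMap.ker Q.mulVecLin) = ⊥) ∧
    ((LinearMap.range P.mulVecLin ⊓ LinearMap.range Q.mulVecLin) ⊔
        (LinearMap.ker P.mulVecLin ⊓ LinearMap.ker Q.mulVecLin) =
      LinearMap.ker (U - 1).mulVecLin) ∧
    (Module.finrank ℂ ↥(LinearMap.ker (U - 1).mulVecLin) + P.rank + Q.rank =
      m + 2 * Module.finrank ℂ
        ↥(LinearMap.range P.mulVecLin ⊓ LinearMap.range Q.mulVecLin)) := by
  have hinf : (LinearMap.range P.mulVecLin ⊓ LinearMap.range Q.mulVecLin) ⊓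
      (LinearMap.ker P.mulVecLin ⊓ LinearMap.ker Q.mulVecLin) = ⊥ := by
    refine (Submodule.eq_bot_iff _).mpr ?_
    rintro x ⟨⟨hx, -⟩, ⟨hx0, -⟩⟩
    exact ((mem_range_mulVecLin_iff_of_mul_self hP2).mp hx).symm.trans hx0
  have hsup : (LinearMap.range P.mulVecLin ⊓ LinearMap.range Q.mulVecLin) ⊔
      (LinearMap.ker P.mulVecLin ⊓ LinearMap.ker Q.mulVecLin) =
        LinearMap.ker (U - 1).mulVecLin := by
    subst hU
    refine le_antisymm (sup_le ?_ ?_) fun x hx => ?_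
    · rintro x ⟨hxP, hxQ⟩
      rw [mem_ker_reflection_mul_reflection_sub_one_iff hP2,
        (mem_range_mulVecLin_iff_of_mul_self hP2).mp hxP,
        (mem_range_mulVecLin_iff_of_mul_self hQ2).mp hxQ]
    · rintro x ⟨hxP, hxQ⟩
      exact (mem_ker_reflection_mul_reflection_sub_one_iff hP2).mpr
        (Eq.trans hxP (Eq.symm hxQ))
    · rw [mem_ker_reflection_mul_reflection_sub_one_iff hP2] at hx
      refine Submodule.mem_sup.mpr ⟨P *ᵥ x, ⟨⟨x, rfl⟩, ⟨x, hx.symm⟩⟩, x - P *ᵥ x, ⟨?_, ?_⟩,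
        add_sub_cancel _ _⟩
      · simp [mulVec_sub, mulVec_mulVec, hP2]
      · simp [hx, mulVec_sub, mulVec_mulVec, hQ2]
  refine ⟨hinf, hsup, ?_⟩
  have hdim := Submodule.finrank_sup_add_finrank_inf_eq
    (LinearMap.range P.mulVecLin ⊓ LinearMap.range Q.mulVecLin)
    (LinearMap.ker P.mulVecLin ⊓ LinearMap.ker Q.mulVecLin)
  rw [hinf, hsup, finrank_bot] at hdim
  have hranges := Submodule.finrank_sup_add_finrank_inf_eq
    (LinearMap.range P.mulVecLin) (LinearMap.range Q.mulVecLin)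
  have hcompl := hP.finrank_ker_inf_ker_add_finrank_range_sup_range hQ
  rw [Fintype.card_fin] at hcompl
  unfold Matrix.rank
  omega
end

section
/- Let P and Q be orthogonal projections on ℂ^m (complex m×m matrices with P = P* = P² and Q = Q* = Q²) and let U = (2P − I)(2Q − I). Then the (−1)-eigenspace of U decomposes as ker(U + I) = (range P ∩ ker Q) ⊕ (ker P ∩ range Q) (the two summands intersect trivially and their sum is ker(U + I)). -/
open Matrix

namespace Matrix

variable {n R : Type*} [Fintype n]

theorem mem_range_mulVecLin_iff_of_mul_self_s1 [CommSemiring R] {P : Matrix n n R}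
    (hP : P * P = P) {v : n → R} :
    v ∈ LinearMap.range P.mulVecLin ↔ P *ᵥ v = v := by
  constructor
  · rintro ⟨w, rfl⟩
    simp [hP]
  · exact fun h => ⟨v, h⟩

theorem reflection_mul_self [DecidableEq n] [CommRing R] {P : Matrix n n R} (hP : P * P = P) :
    ((2 : R) • P - 1) * ((2 : R) • P - 1) = 1 := by
  simp only [mul_sub, sub_mul, smul_mul_assoc, mul_smul_comm, hP, mul_one, one_mul]
  module

theorem reflection_mulVec_eq_zero_iff [DecidableEq n] [CommRing R] {P : Matrix n n R}
    (hP : P * P = P) {v : n → R} : ((2 : R) • P - 1) *ᵥ v = 0 ↔ v = 0 := by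
  refine ⟨fun h => ?_, fun h => by rw [h, mulVec_zero]⟩
  rw [← one_mulVec v, ← reflection_mul_self hP, ← mulVec_mulVec, h, mulVec_zero]

/-- Since `2P - 1` is an involution, `(2P - 1)(2Q - 1)v = -v` says `(2Q - 1)v = -(2P - 1)v`. -/
theorem mem_ker_reflection_mul_reflection_add_one_iff [DecidableEq n] [Field R] [NeZero (2 : R)]
    {P Q : Matrix n n R} (hP : P * P = P) {v : n → R} :
    v ∈ LinearMap.ker (((2 : R) • P - 1) * ((2 : R) • Q - 1) + 1).mulVecLin ↔
      P *ᵥ v + Q *ᵥ v = v := by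
  have hfactor : ((2 : R) • P - 1) * ((2 : R) • Q - 1) + 1 =
      ((2 : R) • P - 1) * ((2 : R) • (P + Q - 1)) := by
    have hsum : (2 : R) • (P + Q - 1) = ((2 : R) • Q - 1) + ((2 : R) • P - 1) := by module
    rw [hsum, mul_add, reflection_mul_self hP]
  rw [LinearMap.mem_ker, mulVecLin_apply, hfactor, ← mulVec_mulVec,
    reflection_mulVec_eq_zero_iff hP, smul_mulVec, smul_eq_zero_iff_right two_ne_zero, sub_mulVec,
    add_mulVec, one_mulVec, sub_eq_zero]

end Matrix

/-- For orthogonal projections `P, Q` on `ℂ^m` and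
`U = (2P − I)(2Q − I)`, the `(−1)`-eigenspace of `U` decomposes as
`ker(U + I) = (range P ∩ ker Q) ⊕ (ker P ∩ range Q)`. -/
theorem neg_one_eigenspace_of_product_of_reflections
    (m : ℕ) (P Q U : Matrix (Fin m) (Fin m) ℂ)
    (hP : P.IsHermitian) (hP2 : P * P = P)
    (hQ : Q.IsHermitian) (hQ2 : Q * Q = Q)
    (hU : U = ((2 : ℂ) • P - 1) * ((2 : ℂ) • Q - 1)) :
    ((LinearMap.range P.mulVecLin ⊓ LinearMap.ker Q.mulVecLin) ⊓
        (LinearMap.ker P.mulVecLin ⊓ LinearMap.range Q.mulVecLin) = ⊥) ∧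
    ((LinearMap.range P.mulVecLin ⊓ LinearMap.ker Q.mulVecLin) ⊔
        (LinearMap.ker P.mulVecLin ⊓ LinearMap.range Q.mulVecLin) =
      LinearMap.ker (U + 1).mulVecLin) := by
  subst hU
  constructor
  · rw [Submodule.eq_bot_iff]
    rintro v ⟨⟨hvP, -⟩, hvP', -⟩
    rw [SetLike.mem_coe, mem_range_mulVecLin_iff_of_mul_self_s1 hP2] at hvP
    rw [← hvP]
    exact hvP'
  · ext v
    rw [mem_ker_reflection_mul_reflection_add_one_iff hP2, Submodule.mem_sup]
    simp only [Submodule.mem_inf, mem_range_mulVecLin_iff_of_mul_self_s1 hP2,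
      mem_range_mulVecLin_iff_of_mul_self_s1 hQ2, LinearMap.mem_ker, mulVecLin_apply]
    constructor
    · rintro ⟨a, ⟨hPa, hQa⟩, b, ⟨hPb, hQb⟩, rfl⟩
      simp [mulVec_add, hPa, hQa, hPb, hQb]
    · intro h
      have hPQ : P *ᵥ Q *ᵥ v = 0 := by
        simpa [mulVec_add, hP2] using congrArg (P *ᵥ ·) h
      have hQP : Q *ᵥ P *ᵥ v = 0 := by
        simpa [mulVec_add, hQ2] using congrArg (Q *ᵥ ·) h
      exact ⟨P *ᵥ v, ⟨by rw [mulVec_mulVec, hP2], hQP⟩,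
        Q *ᵥ v, ⟨hPQ, by rw [mulVec_mulVec, hQ2]⟩, h⟩
end

section
/- In the bipartite-walk matrix setup, the dimension of the (−1)-eigenspace of U satisfies dim_ℂ ker(U + I) = a + b − 2·rank(Ĉ). -/
open Matrix

/-- If `f'` and `g'` are left inverses of `f` and `g`, the space of vectors fixed by
`f ∘ f' + g ∘ g'` is the direct sum of the kernels of `g' ∘ f` and `f' ∘ g`. -/
def LinearMap.kerCompAddCompSubIdEquiv {R U V W : Type*} [Ring R] [AddCommGroup U] [Module R U]
    [AddCommGroup V] [Module R V] [AddCommGroup W] [Module R W]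
    (f : U →ₗ[R] W) (f' : W →ₗ[R] U) (g : V →ₗ[R] W) (g' : W →ₗ[R] V)
    (hf : f' ∘ₗ f = LinearMap.id) (hg : g' ∘ₗ g = LinearMap.id) :
    ker (f ∘ₗ f' + g ∘ₗ g' - LinearMap.id) ≃ₗ[R] ker (g' ∘ₗ f) × ker (f' ∘ₗ g) :=
  have hfu (u : U) : f' (f u) = u := LinearMap.congr_fun hf u
  have hgv (v : V) : g' (g v) = v := LinearMap.congr_fun hg v
  have hx (x : ker (f ∘ₗ f' + g ∘ₗ g' - LinearMap.id)) : f (f' x) + g (g' x) = x :=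
    sub_eq_zero.1 (LinearMap.mem_ker.1 x.2)
  have hu (u : ker (g' ∘ₗ f)) : g' (f u) = 0 := u.2
  have hv (v : ker (f' ∘ₗ g)) : f' (g v) = 0 := v.2
  { toFun x :=
      (⟨f' x, by simpa [hgv] using congrArg g' (hx x)⟩,
        ⟨g' x, by simpa [hfu] using congrArg f' (hx x)⟩)
    map_add' x y := by ext <;> simp
    map_smul' c x := by ext <;> simp
    invFun y := ⟨f y.1 + g y.2, by simp [hfu, hgv, hu, hv]⟩
    left_inv x := Subtype.ext (hx x)
    right_inv y := by ext <;> simp [hfu, hgv, hu, hv] }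

namespace Matrix

/-- The rank of a square matrix is invariant under an extension of the base field. -/
theorem rank_map_ringHom_of_square {n K L : Type*} [Fintype n] [DecidableEq n] [Field K] [Field L]
    (f : K →+* L) (M : Matrix n n K) : (M.map f).rank = M.rank := by
  classical
  obtain ⟨V, W, e, hV, hW, h⟩ := M.exists_rank_normal_form
  have hdiag : V * M * W = diagonal (Sum.elim 1 0 ∘ e) := by
    rw [h, ← submatrix_diagonal_equiv, ← fromBlocks_diagonal, Pi.one_def, diagonal_one,
      Pi.zero_def, diagonal_zero]
  have hmap : V.map f * M.map f * W.map f =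
      diagonal (fun i ↦ f ((Sum.elim 1 0 ∘ e : n → K) i)) := by
    rw [← Matrix.map_mul, ← Matrix.map_mul, hdiag, diagonal_map (map_zero f)]
  have hV' : IsUnit (V.map f) := hV.map f.mapMatrix
  have hW' : IsUnit (W.map f) := hW.map f.mapMatrix
  calc (M.map f).rank = (V.map f * M.map f * W.map f).rank := by
        rw [rank_mul_eq_left_of_isUnit_det _ _ ((isUnit_iff_isUnit_det _).1 hW'),
          rank_mul_eq_right_of_isUnit_det _ _ ((isUnit_iff_isUnit_det _).1 hV')]
    _ = (V * M * W).rank := by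
        rw [hmap, hdiag, rank_diagonal, rank_diagonal]
        simp only [ne_eq, map_eq_zero]
    _ = M.rank := by
        rw [rank_mul_eq_left_of_isUnit_det _ _ ((isUnit_iff_isUnit_det _).1 hW),
          rank_mul_eq_right_of_isUnit_det _ _ ((isUnit_iff_isUnit_det _).1 hV)]

open ComplexOrder in
/-- The rank of a real matrix does not change when it is regarded as a complex matrix. -/
theorem rank_map_complexOfReal {m n : Type*} [Fintype m] [Fintype n] (A : Matrix m n ℝ) :
    (A.map Complex.ofRealHom).rank = A.rank := by
  classical
  have h : (A.map Complex.ofRealHom)ᴴ = Aᵀ.map Complex.ofRealHom := by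
    ext i j
    simp
  rw [← rank_conjTranspose_mul_self, h, ← Matrix.map_mul, rank_map_ringHom_of_square,
    rank_transpose_mul_self]

theorem finrank_ker_mulVecLin_add_rank {m n K : Type*} [Fintype n] [Field K]
    (A : Matrix m n K) :
    Module.finrank K (LinearMap.ker A.mulVecLin) + A.rank = Fintype.card n := by
  rw [add_comm, Matrix.rank, LinearMap.finrank_range_add_finrank_ker,
    Module.finrank_fintype_fun_eq_card]

section Projections

variable {m a b K : Type*} [Fintype m] [DecidableEq m] [Fintype a] [DecidableEq a] [Fintype b]
  [DecidableEq b] [Field K] {A : Matrix m a K} {B : Matrix m b K}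

/-- Let `P` be idempotent. If `2 ≠ 0`, a vector is negated by `(2P - 1)(2Q - 1)` if and only if it is
fixed by `P + Q`. -/
theorem ker_reflection_mul_reflection_add_one {P Q : Matrix m m K} (h2 : (2 : K) ≠ 0)
    (hP : P * P = P) :
    LinearMap.ker (((2 : K) • P - 1) * ((2 : K) • Q - 1) + 1).mulVecLin =
      LinearMap.ker (P + Q - 1).mulVecLin := by
  have hR : ((2 : K) • P - 1) * ((2 : K) • P - 1) = 1 := by
    simp only [Matrix.sub_mul, Matrix.mul_sub, Matrix.smul_mul, Matrix.mul_smul, hP,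
      Matrix.mul_one, Matrix.one_mul]
    module
  have hfac : ((2 : K) • P - 1) * ((2 : K) • Q - 1) + 1 =
      ((2 : K) • P - 1) * ((2 : K) • (P + Q - 1)) := by
    calc _ = ((2 : K) • P - 1) * ((2 : K) • Q - 1) + ((2 : K) • P - 1) * ((2 : K) • P - 1) := by
          rw [hR]
      _ = _ := by
          rw [← Matrix.mul_add]
          congr 1
          module
  have hfac' : (2 : K) • (P + Q - 1) =
      ((2 : K) • P - 1) * (((2 : K) • P - 1) * ((2 : K) • Q - 1) + 1) := by
    rw [hfac, ← Matrix.mul_assoc, hR, Matrix.one_mul]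
  ext x
  simp only [LinearMap.mem_ker, mulVecLin_apply]
  constructor
  · intro h
    have h' : (2 : K) • ((P + Q - 1) *ᵥ x) = 0 := by
      rw [← smul_mulVec, hfac', ← mulVec_mulVec, h, mulVec_zero]
    exact (smul_eq_zero.1 h').resolve_left h2
  · intro h
    rw [hfac, ← mulVec_mulVec, smul_mulVec, h, smul_zero, mulVec_zero]

/-- If `A` and `B` have orthonormal columns, the space of vectors fixed by `AAᵀ + BBᵀ` has the same
dimension as the direct sum of the kernels of `BᵀA` and of its transpose. -/
theorem finrank_ker_mul_transpose_add_mul_transpose_sub_one (hA : Aᵀ * A = 1) (hB : Bᵀ * B = 1) :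
    Module.finrank K (LinearMap.ker (A * Aᵀ + B * Bᵀ - 1).mulVecLin) =
      Module.finrank K (LinearMap.ker (Bᵀ * A).mulVecLin) +
        Module.finrank K (LinearMap.ker (Aᵀ * B).mulVecLin) := by
  have hA' : Aᵀ.mulVecLin ∘ₗ A.mulVecLin = LinearMap.id := by rw [← mulVecLin_mul, hA, mulVecLin_one]
  have hB' : Bᵀ.mulVecLin ∘ₗ B.mulVecLin = LinearMap.id := by rw [← mulVecLin_mul, hB, mulVecLin_one]
  have hsum : (A * Aᵀ + B * Bᵀ - 1).mulVecLin =
      A.mulVecLin ∘ₗ Aᵀ.mulVecLin + B.mulVecLin ∘ₗ Bᵀ.mulVecLin - LinearMap.id := by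
    rw [← mulVecLin_mul, ← mulVecLin_mul, ← mulVecLin_add, ← mulVecLin_one]
    refine LinearMap.ext fun x ↦ ?_
    simp
  rw [hsum, (LinearMap.kerCompAddCompSubIdEquiv _ _ _ _ hA' hB').finrank_eq,
    Module.finrank_prod, mulVecLin_mul, mulVecLin_mul]

theorem finrank_ker_reflection_mul_reflection_add_one (h2 : (2 : K) ≠ 0)
    (hA : Aᵀ * A = 1) (hB : Bᵀ * B = 1) :
    Module.finrank K (LinearMap.ker
        (((2 : K) • (A * Aᵀ) - 1) * ((2 : K) • (B * Bᵀ) - 1) + 1).mulVecLin) +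
      2 * (Bᵀ * A).rank = Fintype.card a + Fintype.card b := by
  have htr : (Aᵀ * B).rank = (Bᵀ * A).rank := by
    rw [← rank_transpose, transpose_mul, transpose_transpose]
  have h₁ := finrank_ker_mulVecLin_add_rank (Bᵀ * A)
  have h₂ := finrank_ker_mulVecLin_add_rank (Aᵀ * B)
  have hP : (A * Aᵀ) * (A * Aᵀ) = A * Aᵀ := by
    rw [Matrix.mul_assoc, ← Matrix.mul_assoc Aᵀ, hA, Matrix.one_mul]
  rw [ker_reflection_mul_reflection_add_one h2 hP,
    finrank_ker_mul_transpose_add_mul_transpose_sub_one hA hB]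
  lia

end Projections

end Matrix

/-- In the bipartite-walk matrix setup
(`P̂₀ : m×a`, `P̂₁ : m×b` real with orthonormal columns,
`P = P̂₀P̂₀ᵀ`, `Q = P̂₁P̂₁ᵀ`, `Ĉ = P̂₁ᵀP̂₀`, `U = (2P − I)(2Q − I)` over `ℂ`),
the dimension of the `(−1)`-eigenspace of `U` is `a + b − 2·rank(Ĉ)`,
stated additively as `dim ker(U + I) + 2·rank(Ĉ) = a + b`. -/
theorem dim_neg_one_eigenspace_of_bipartite_walk
    (m a b : ℕ) (hm : 0 < m) (ha : 0 < a) (hb : 0 < b)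
    (P₀ : Matrix (Fin m) (Fin a) ℝ) (P₁ : Matrix (Fin m) (Fin b) ℝ)
    (hP₀ : P₀ᵀ * P₀ = 1) (hP₁ : P₁ᵀ * P₁ = 1)
    (P Q : Matrix (Fin m) (Fin m) ℝ) (C : Matrix (Fin b) (Fin a) ℝ)
    (hP : P = P₀ * P₀ᵀ) (hQ : Q = P₁ * P₁ᵀ) (hC : C = P₁ᵀ * P₀)
    (U : Matrix (Fin m) (Fin m) ℂ)
    (hU : U = (((2 : ℝ) • P - 1) * ((2 : ℝ) • Q - 1)).map Complex.ofReal) :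
    Module.finrank ℂ ↥(LinearMap.ker (U + 1).mulVecLin) + 2 * C.rank = a + b := by
  subst hP hQ hC hU
  have hmapA : (P₀.map Complex.ofRealHom)ᵀ * P₀.map Complex.ofRealHom = 1 := by
    rw [← transpose_map, ← Matrix.map_mul, hP₀, Matrix.map_one _ (map_zero _) (map_one _)]
  have hmapB : (P₁.map Complex.ofRealHom)ᵀ * P₁.map Complex.ofRealHom = 1 := by
    rw [← transpose_map, ← Matrix.map_mul, hP₁, Matrix.map_one _ (map_zero _) (map_one _)]
  have hrefl {n : ℕ} (A : Matrix (Fin m) (Fin n) ℝ) :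
      ((2 : ℝ) • (A * Aᵀ) - 1).map Complex.ofRealHom =
        (2 : ℂ) • (A.map Complex.ofRealHom * (A.map Complex.ofRealHom)ᵀ) - 1 := by
    rw [← transpose_map, ← Matrix.map_mul, Matrix.map_sub _ (map_sub _),
      Matrix.map_one _ (map_zero _) (map_one _)]
    congr 1
    ext i j
    simp only [map_apply, Matrix.smul_apply, smul_eq_mul, map_mul, map_ofNat]
  have h := finrank_ker_reflection_mul_reflection_add_one two_ne_zero hmapA hmapB
  rw [← hrefl, ← hrefl, ← Matrix.map_mul, ← transpose_map, ← Matrix.map_mul,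
    rank_map_complexOfReal, Fintype.card_fin, Fintype.card_fin] at h
  exact h
end

section
/- In the bipartite-walk matrix setup, let μ ∈ (0,1) be an eigenvalue of the real symmetric matrix ĈĈᵀ and let θ ∈ (0, π) satisfy cos θ = 2μ − 1. Then the linear map ℂ^b → ℂ^m given by y ↦ (cos θ + 1)·P̂₁y − (e^{iθ} + 1)·P̂₀Ĉᵀy restricts to a linear isomorphism from the μ-eigenspace {y ∈ ℂ^b : ĈĈᵀy = μy} onto the e^{iθ}-eigenspace {z ∈ ℂ^m : Uz = e^{iθ}z}, and the map y ↦ (cos θ + 1)·P̂₁y − (e^{−iθ} + 1)·P̂₀Ĉᵀy restricts to a linear isomorphism from the μ-eigenspace of ĈĈᵀ onto the e^{−iθ}-eigenspace {z ∈ ℂ^m : Uz = e^{−iθ}z}. -/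
open Matrix

theorem two_smul_mul_transpose_sub_one_mulVec {K m n : Type*} [CommRing K] [Fintype m] [Fintype n]
    [DecidableEq m] (M : Matrix m n K) (z : m → K) :
    ((2 : K) • (M * Mᵀ) - 1) *ᵥ z = (2 : K) • M *ᵥ (Mᵀ *ᵥ z) - z := by
  rw [sub_mulVec, smul_mulVec, ← mulVec_mulVec, one_mulVec]

/-- If `(l + 1) ^ 2 = 4 * μ * l` with `μ ≠ 0` and `l ≠ 1`, then
`y ↦ 2μ • B y - (l + 1) • A Cᵀ y`, where `C = Bᵀ A`, maps the `μ`-eigenspace of `C Cᵀ` injectively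
onto the `l`-eigenspace of the product of reflections `(2 A Aᵀ - 1) (2 B Bᵀ - 1)`. -/
theorem map_eigenspace_eq_eigenspace_reflection_mul {K m a b : Type*} [Field K] [NeZero (2 : K)]
    [Fintype m] [Fintype a] [Fintype b] [DecidableEq m] [DecidableEq a] [DecidableEq b]
    {A : Matrix m a K} {B : Matrix m b K} (hA : Aᵀ * A = 1) (hB : Bᵀ * B = 1)
    {l μ : K} (hl : (l + 1) ^ 2 = 4 * μ * l) (hμ : μ ≠ 0) (hl₁ : l ≠ 1) :
    Submodule.map ((2 * μ) • B - (l + 1) • (A * (Bᵀ * A)ᵀ)).mulVecLin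
        (LinearMap.ker (((Bᵀ * A) * (Bᵀ * A)ᵀ).mulVecLin - μ • LinearMap.id)) =
      LinearMap.ker ((((2 : K) • (A * Aᵀ) - 1) * ((2 : K) • (B * Bᵀ) - 1)).mulVecLin -
        l • LinearMap.id) ∧
    ∀ y ∈ LinearMap.ker (((Bᵀ * A) * (Bᵀ * A)ᵀ).mulVecLin - μ • LinearMap.id),
      ((2 * μ) • B - (l + 1) • (A * (Bᵀ * A)ᵀ)) *ᵥ y = 0 → y = 0 := by
  have h2 : (2 : K) ≠ 0 := two_ne_zero
  have hl₀ : l ≠ 0 := by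
    rintro rfl
    simp at hl
  have hl₁' : 1 - l ≠ 0 := sub_ne_zero.mpr hl₁.symm
  have hAA (x : a → K) : Aᵀ *ᵥ (A *ᵥ x) = x := by rw [mulVec_mulVec, hA, one_mulVec]
  have hBB (y : b → K) : Bᵀ *ᵥ (B *ᵥ y) = y := by rw [mulVec_mulVec, hB, one_mulVec]
  have hE (y : b → K) :
      y ∈ LinearMap.ker (((Bᵀ * A) * (Bᵀ * A)ᵀ).mulVecLin - μ • LinearMap.id) ↔
        Bᵀ *ᵥ (A *ᵥ (Aᵀ *ᵥ (B *ᵥ y))) = μ • y := by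
    rw [LinearMap.mem_ker, LinearMap.sub_apply, LinearMap.smul_apply, LinearMap.id_apply,
      mulVecLin_apply, sub_eq_zero, transpose_mul, transpose_transpose]
    simp only [← mulVec_mulVec]
  have hL (y : b → K) : ((2 * μ) • B - (l + 1) • (A * (Bᵀ * A)ᵀ)) *ᵥ y =
      (2 * μ) • B *ᵥ y - (l + 1) • A *ᵥ (Aᵀ *ᵥ (B *ᵥ y)) := by
    simp [sub_mulVec, smul_mulVec, ← mulVec_mulVec]
  have hBL (y : b → K) (hy : Bᵀ *ᵥ (A *ᵥ (Aᵀ *ᵥ (B *ᵥ y))) = μ • y) :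
      Bᵀ *ᵥ ((2 * μ) • B *ᵥ y - (l + 1) • A *ᵥ (Aᵀ *ᵥ (B *ᵥ y))) = (μ * (1 - l)) • y := by
    rw [mulVec_sub, mulVec_smul, mulVec_smul, hBB, hy]
    module
  refine ⟨le_antisymm ?_ ?_, ?_⟩
  · rintro _ ⟨y, hy, rfl⟩
    have hy := (hE y).1 hy
    rw [LinearMap.mem_ker, LinearMap.sub_apply, LinearMap.smul_apply, LinearMap.id_apply,
      mulVecLin_apply, mulVecLin_apply, ← mulVec_mulVec, hL,
      two_smul_mul_transpose_sub_one_mulVec B, hBL y hy, two_smul_mul_transpose_sub_one_mulVec A]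
    simp only [mulVec_sub, mulVec_smul, hAA]
    linear_combination (norm := module) hl • (A *ᵥ (Aᵀ *ᵥ (B *ᵥ y)))
  · intro z hz
    rw [LinearMap.mem_ker, LinearMap.sub_apply, LinearMap.smul_apply, LinearMap.id_apply,
      mulVecLin_apply, ← mulVec_mulVec, sub_eq_zero] at hz
    have hAinv (w : m → K) :
        ((2 : K) • (A * Aᵀ) - 1) *ᵥ (((2 : K) • (A * Aᵀ) - 1) *ᵥ w) = w := by
      simp only [two_smul_mul_transpose_sub_one_mulVec, mulVec_sub, mulVec_smul, hAA]
      module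
    have hz := congrArg (((2 : K) • (A * Aᵀ) - 1) *ᵥ ·) hz
    simp only [hAinv, mulVec_smul] at hz
    rw [two_smul_mul_transpose_sub_one_mulVec, two_smul_mul_transpose_sub_one_mulVec] at hz
    have hzB := congrArg (Bᵀ *ᵥ ·) hz
    have hzA := congrArg (Aᵀ *ᵥ ·) hz
    simp only [mulVec_sub, mulVec_smul, hAA, hBB] at hzA hzB
    have hzBA := congrArg (fun x => Bᵀ *ᵥ (A *ᵥ x)) hzA
    have hzAA := congrArg (A *ᵥ ·) hzA
    simp only [mulVec_sub, mulVec_smul] at hzBA hzAA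
    have hy : Bᵀ *ᵥ (A *ᵥ (Aᵀ *ᵥ (B *ᵥ (Bᵀ *ᵥ z)))) = μ • (Bᵀ *ᵥ z) := by
      refine smul_right_injective _ (mul_ne_zero (mul_ne_zero h2 h2) hl₀) ?_
      linear_combination (norm := module) (2 * l) • hzBA - (l + 1) • hzB + hl • (Bᵀ *ᵥ z)
    refine ⟨(μ * (1 - l))⁻¹ • (Bᵀ *ᵥ z), ?_, ?_⟩
    · exact Submodule.smul_mem _ _ ((hE _).2 hy)
    · rw [map_smul, mulVecLin_apply, hL, inv_smul_eq_iff₀ (mul_ne_zero hμ hl₁')]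
      refine smul_right_injective _ h2 ?_
      linear_combination (norm := module) (2 * μ) • hz - (l + 1) • hzAA - hl • (A *ᵥ (Aᵀ *ᵥ z))
  · intro y hy h
    have := hBL y ((hE y).1 hy)
    rw [← hL, h, mulVec_zero] at this
    exact (smul_eq_zero.1 this.symm).resolve_left (mul_ne_zero hμ hl₁')

/-- In the bipartite-walk matrix setup, for an eigenvalue
`μ ∈ (0,1)` of `ĈĈᵀ` and `θ ∈ (0,π)` with `cos θ = 2μ − 1`, the map
`y ↦ (cos θ + 1)·P̂₁y − (e^{±iθ} + 1)·P̂₀Ĉᵀy` restricts to a linear isomorphism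
from the `μ`-eigenspace of `ĈĈᵀ` onto the `e^{±iθ}`-eigenspace of `U`
(it maps the `μ`-eigenspace onto the `e^{±iθ}`-eigenspace and is injective there). -/
theorem eigenspace_isomorphism_of_bipartite_walk
    (m a b : ℕ) (hm : 0 < m) (ha : 0 < a) (hb : 0 < b)
    (P₀ : Matrix (Fin m) (Fin a) ℝ) (P₁ : Matrix (Fin m) (Fin b) ℝ)
    (hP₀ : P₀ᵀ * P₀ = 1) (hP₁ : P₁ᵀ * P₁ = 1)
    (P Q : Matrix (Fin m) (Fin m) ℝ) (C : Matrix (Fin b) (Fin a) ℝ)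
    (hP : P = P₀ * P₀ᵀ) (hQ : Q = P₁ * P₁ᵀ) (hC : C = P₁ᵀ * P₀)
    (U : Matrix (Fin m) (Fin m) ℂ)
    (hU : U = (((2 : ℝ) • P - 1) * ((2 : ℝ) • Q - 1)).map Complex.ofReal)
    (μ : ℝ) (hμmem : μ ∈ Set.Ioo (0 : ℝ) 1)
    (hμeig : ∃ y : Fin b → ℝ, y ≠ 0 ∧ (C * Cᵀ).mulVec y = μ • y)
    (θ : ℝ) (hθmem : θ ∈ Set.Ioo (0 : ℝ) Real.pi)
    (hθ : Real.cos θ = 2 * μ - 1)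
    -- the `μ`-eigenspace of `ĈĈᵀ` (over `ℂ`)
    (Eμ : Submodule ℂ (Fin b → ℂ))
    (hEμ : Eμ = LinearMap.ker
      (((C * Cᵀ).map Complex.ofReal).mulVecLin - (μ : ℂ) • LinearMap.id))
    -- the two linear maps `ℂ^b → ℂ^m`
    (Lplus Lminus : Matrix (Fin m) (Fin b) ℂ)
    (hLp : Lplus = ((Real.cos θ + 1 : ℝ) : ℂ) • (P₁.map Complex.ofReal) -
      (Complex.exp (θ * Complex.I) + 1) •
        ((P₀.map Complex.ofReal) * (Cᵀ.map Complex.ofReal)))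
    (hLm : Lminus = ((Real.cos θ + 1 : ℝ) : ℂ) • (P₁.map Complex.ofReal) -
      (Complex.exp (-(θ * Complex.I)) + 1) •
        ((P₀.map Complex.ofReal) * (Cᵀ.map Complex.ofReal))) :
    (Submodule.map Lplus.mulVecLin Eμ =
        LinearMap.ker (U.mulVecLin - Complex.exp (θ * Complex.I) • LinearMap.id) ∧
      ∀ y ∈ Eμ, Lplus.mulVec y = 0 → y = 0) ∧
    (Submodule.map Lminus.mulVecLin Eμ =
        LinearMap.ker (U.mulVecLin - Complex.exp (-(θ * Complex.I)) • LinearMap.id) ∧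
      ∀ y ∈ Eμ, Lminus.mulVec y = 0 → y = 0) := by
  have hmap {k n p : ℕ} (M : Matrix (Fin k) (Fin n) ℝ) (N : Matrix (Fin n) (Fin p) ℝ) :
      (M * N).map Complex.ofReal = M.map Complex.ofReal * N.map Complex.ofReal :=
    Matrix.map_mul (f := Complex.ofRealHom)
  have hone {k : ℕ} : (1 : Matrix (Fin k) (Fin k) ℝ).map Complex.ofReal = 1 :=
    Matrix.map_one _ Complex.ofReal_zero Complex.ofReal_one
  have hrefl (M : Matrix (Fin m) (Fin m) ℝ) :
      ((2 : ℝ) • M - 1).map Complex.ofReal = (2 : ℂ) • M.map Complex.ofReal - 1 := by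
    rw [← hone]
    ext i j
    simp only [map_apply, Matrix.sub_apply, Matrix.smul_apply, smul_eq_mul, Complex.ofReal_sub,
      Complex.ofReal_mul, Complex.ofReal_ofNat]
  have hA : (P₀.map Complex.ofReal)ᵀ * P₀.map Complex.ofReal = 1 := by
    rw [← transpose_map, ← hmap, hP₀, hone]
  have hB : (P₁.map Complex.ofReal)ᵀ * P₁.map Complex.ofReal = 1 := by
    rw [← transpose_map, ← hmap, hP₁, hone]
  have hcos : Complex.exp (θ * Complex.I) + Complex.exp (-(θ * Complex.I)) = 2 * (2 * μ - 1) := by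
    have h := Complex.two_cos (θ : ℂ)
    rw [← Complex.ofReal_cos, hθ, neg_mul] at h
    push_cast at h
    exact h.symm
  have hmul : Complex.exp (θ * Complex.I) * Complex.exp (-(θ * Complex.I)) = 1 := by
    rw [← Complex.exp_add, add_neg_cancel, Complex.exp_zero]
  have hμ₀ : (μ : ℂ) ≠ 0 := Complex.ofReal_ne_zero.2 hμmem.1.ne'
  have hμ₁ : (μ : ℂ) ≠ 1 := by exact_mod_cast hμmem.2.ne
  have hcoef : ((Real.cos θ + 1 : ℝ) : ℂ) = 2 * μ := by
    rw [hθ]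
    push_cast
    ring
  have key (l l' : ℂ) (hadd : l + l' = 2 * (2 * μ - 1)) (hll : l * l' = 1) :=
    map_eigenspace_eq_eigenspace_reflection_mul hA hB (l := l) (μ := μ)
      (by linear_combination l * hadd - hll) hμ₀ (by
        rintro rfl
        apply hμ₁
        linear_combination (hll - hadd) / 4)
  subst hEμ hLp hLm hU hP hQ hC
  simp only [hcoef, hmap, hrefl, transpose_mul, transpose_map, transpose_transpose] at key ⊢
  exact ⟨key _ _ hcos hmul, key _ _ (by rw [add_comm, hcos]) (by rw [mul_comm, hmul])⟩
end

section
/- In the bipartite-walk matrix setup, let μ ∈ (0,1) be an eigenvalue of ĈĈᵀ, let θ ∈ (0, π) satisfy cos θ = 2μ − 1, let F_μ be the orthogonal projection onto the μ-eigenspace of ĈĈᵀ, and set W = P̂₁F_μP̂₁ᵀ. Then the matrix (1/sin²θ)·((cos θ + 1)W − (e^{iθ} + 1)PW − (e^{−iθ} + 1)WP + 2PWP) is the orthogonal projection of ℂ^m onto the e^{iθ}-eigenspace of U: it is Hermitian, idempotent, and its range equals {z ∈ ℂ^m : Uz = e^{iθ}z}. Likewise (1/sin²θ)·((cos θ + 1)W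 − (e^{−iθ} + 1)PW − (e^{iθ} + 1)WP + 2PWP) is the orthogonal projection onto the e^{−iθ}-eigenspace of U. -/
open Matrix

/-- Real matrices act on the real part of a complex vector. -/
lemma Matrix.re_map_ofReal_mulVec {k l : Type*} [Fintype l] (M : Matrix k l ℝ) (z : l → ℂ) :
    (fun i => ((M.map Complex.ofReal).mulVec z i).re) = M.mulVec fun j => (z j).re := by
  ext i
  simp [mulVec, dotProduct]

/-- Real matrices act on the imaginary part of a complex vector. -/
lemma Matrix.im_map_ofReal_mulVec {k l : Type*} [Fintype l] (M : Matrix k l ℝ) (z : l → ℂ) :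
    (fun i => ((M.map Complex.ofReal).mulVec z i).im) = M.mulVec fun j => (z j).im := by
  ext i
  simp [mulVec, dotProduct]

/-- A containment of equalizers of real matrices persists over `ℂ`. -/
lemma Matrix.map_ofReal_mulVec_eq_of_real {k l : Type*} [Fintype l] {M N A B : Matrix k l ℝ}
    (h : ∀ x : l → ℝ, M.mulVec x = N.mulVec x → A.mulVec x = B.mulVec x) (z : l → ℂ)
    (hz : (M.map Complex.ofReal).mulVec z = (N.map Complex.ofReal).mulVec z) :
    (A.map Complex.ofReal).mulVec z = (B.map Complex.ofReal).mulVec z := by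
  have hre := h (fun j => (z j).re) (by
    rw [← re_map_ofReal_mulVec, ← re_map_ofReal_mulVec, hz])
  have him := h (fun j => (z j).im) (by
    rw [← im_map_ofReal_mulVec, ← im_map_ofReal_mulVec, hz])
  rw [← re_map_ofReal_mulVec, ← re_map_ofReal_mulVec] at hre
  rw [← im_map_ofReal_mulVec, ← im_map_ofReal_mulVec] at him
  ext i
  exact Complex.ext (congrFun hre i) (congrFun him i)

/-- The spectral projection of a product of two reflections `(2P - 1)(2Q - 1)` at a unimodular
`l` with `l + l⁻¹ = 4μ - 2`, in terms of the projection `W` onto the `μ`-eigenspace of `QPQ`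
inside the range of `Q`. -/
lemma eigenprojection_of_product_of_reflections {n : Type*} [Fintype n] [DecidableEq n]
    {P Q W U E : Matrix n n ℂ} {μ l l' s : ℂ}
    (hPH : P.IsHermitian) (hWH : W.IsHermitian)
    (hP : P * P = P) (hQ : Q * Q = Q) (hQW : Q * W = W) (hWQ : W * Q = W)
    (hQPW : Q * (P * W) = μ • W)
    (hW : ∀ z, (Q * P * Q).mulVec z = (μ • Q).mulVec z → W.mulVec z = Q.mulVec z)
    (hU : U = ((2 : ℂ) • P - 1) * ((2 : ℂ) • Q - 1))
    (hμ : star μ = μ) (hl : star l = l') (hll : l * l' = 1) (hsum : l + l' = 4 * μ - 2)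
    (hs : s = 4 * μ * (1 - μ)) (hs0 : s ≠ 0)
    (hE : E = s⁻¹ • ((2 * μ) • W - (l + 1) • (P * W) - (l' + 1) • (W * P)
      + (2 : ℂ) • (P * W * P))) :
    E.IsHermitian ∧ E * E = E ∧
      LinearMap.range E.mulVecLin = LinearMap.ker (U.mulVecLin - l • LinearMap.id) := by
  have hl' : star l' = l := by rw [← hl, star_star]
  have hUW : U * W = (2 : ℂ) • (P * W) - W := by
    rw [hU, mul_assoc, sub_mul ((2 : ℂ) • Q), smul_mul_assoc, hQW, one_mul, sub_mul,
      smul_mul_assoc, one_mul, mul_sub, mul_smul_comm]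
    module
  have hUPW : U * (P * W) = (4 * μ - 1) • (P * W) - (2 * μ) • W := by
    rw [hU, mul_assoc, sub_mul ((2 : ℂ) • Q), smul_mul_assoc, hQPW, one_mul, sub_mul,
      smul_mul_assoc, one_mul, mul_sub, mul_smul_comm, mul_smul_comm, ← mul_assoc, hP]
    module
  have hUE : U * E = l • E := by
    rw [hE]
    simp only [mul_smul_comm, mul_add, mul_sub]
    rw [← mul_assoc U W P, ← mul_assoc U (P * W) P, hUW, hUPW]
    simp only [sub_mul, smul_mul_assoc]
    match_scalars
    · linear_combination s⁻¹ * (l * hsum - hll)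
    · ring
    · linear_combination -2 * s⁻¹ * hsum
    · linear_combination s⁻¹ * (hsum + hll)
  have hfix : ∀ z, U.mulVec z = l • z → E.mulVec z = z := by
    intro z hz
    have hRR : ((2 : ℂ) • P - 1) * ((2 : ℂ) • P - 1) = 1 := by
      simp only [sub_mul, mul_sub, smul_mul_assoc, mul_smul_comm, hP, one_mul, mul_one]
      module
    have hPQ : (2 : ℂ) • Q.mulVec z = (2 * l) • P.mulVec z + (1 - l) • z := by
      have h := congrArg ((2 : ℂ) • P - 1).mulVec hz
      rw [hU, mulVec_mulVec, ← mul_assoc, hRR, one_mul, mulVec_smul, sub_mulVec, sub_mulVec,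
        smul_mulVec, smul_mulVec, one_mulVec] at h
      linear_combination (norm := module) h
    have hQPz : (2 : ℂ) • Q.mulVec (P.mulVec z) = (1 + l') • Q.mulVec z := by
      have h := congrArg Q.mulVec hPQ
      rw [mulVec_smul, mulVec_add, mulVec_smul, mulVec_smul, mulVec_mulVec, hQ] at h
      linear_combination (norm := module) (-l') • h - (2 * hll) • Q.mulVec (P.mulVec z)
        + hll • Q.mulVec z
    have hPQz : (2 : ℂ) • P.mulVec (Q.mulVec z) = (1 + l) • P.mulVec z := by
      have h := congrArg P.mulVec hPQ
      rw [mulVec_smul, mulVec_add, mulVec_smul, mulVec_smul, mulVec_mulVec _ P P, hP] at h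
      linear_combination (norm := module) h
    have hWz : W.mulVec z = Q.mulVec z := by
      apply hW
      have h := congrArg Q.mulVec hPQz
      rw [mulVec_smul, mulVec_smul] at h
      rw [← mulVec_mulVec, ← mulVec_mulVec, smul_mulVec]
      linear_combination (norm := module) (1 / 2 : ℂ) • h + ((1 + l) / 4) • hQPz
        + (hll / 4 + hsum / 4) • Q.mulVec z
    have hWPz : (2 : ℂ) • W.mulVec (P.mulVec z) = (1 + l') • Q.mulVec z := by
      have h := congrArg W.mulVec hQPz
      rwa [mulVec_smul, mulVec_smul, mulVec_mulVec _ W Q, mulVec_mulVec _ W Q, hWQ, hWz] at h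
    have hPWPz := congrArg P.mulVec hWPz
    rw [mulVec_smul, mulVec_smul] at hPWPz
    have hsE : s • E.mulVec z = s • z := by
      rw [hE, smul_mulVec, smul_inv_smul₀ hs0, hs]
      simp only [add_mulVec, sub_mulVec, smul_mulVec, ← mulVec_mulVec, hWz]
      linear_combination (norm := module) (-(l + 1) / 2 + (1 + l') / 2) • hPQz
        - ((l' + 1) / 2) • hWPz + hPWPz + (μ * (1 - l')) • hPQ
        + ((hll - l' * hsum) / 2) • Q.mulVec z
        + ((hsum - l * hsum + (2 - 4 * μ) * hll) / 2) • P.mulVec z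
        + (μ * (hll - hsum)) • z
    exact smul_right_injective _ hs0 hsE
  have hmem : ∀ z, U.mulVec (E.mulVec z) = l • E.mulVec z := fun z => by
    rw [mulVec_mulVec, hUE, smul_mulVec]
  refine ⟨?_, ?_, ?_⟩
  · have hsS : star s = s := by simp [hs, hμ]
    rw [IsHermitian, hE]
    simp only [conjTranspose_smul, conjTranspose_add, conjTranspose_sub, conjTranspose_mul,
      hPH.eq, hWH.eq, star_inv₀, hsS, star_add, star_mul', hμ, hl, hl', star_one, star_ofNat,
      mul_assoc]
    module
  · refine ext_of_mulVec_single fun i => ?_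
    rw [← mulVec_mulVec, hfix _ (hmem _)]
  · ext z
    simp only [LinearMap.mem_range, mulVecLin_apply, LinearMap.mem_ker, LinearMap.sub_apply,
      LinearMap.smul_apply, LinearMap.id_apply, sub_eq_zero]
    exact ⟨by rintro ⟨y, rfl⟩; exact hmem y, fun h => ⟨z, hfix z h⟩⟩

/-- In the bipartite-walk matrix setup, for an eigenvalue
`μ ∈ (0,1)` of `ĈĈᵀ`, `θ ∈ (0,π)` with `cos θ = 2μ − 1`, `F_μ` the orthogonal
projection onto the `μ`-eigenspace of `ĈĈᵀ`, and `W = P̂₁F_μP̂₁ᵀ`, the matrix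
`(1/sin²θ)((cos θ + 1)W − (e^{±iθ} + 1)PW − (e^{∓iθ} + 1)WP + 2PWP)` is the
orthogonal projection of `ℂ^m` onto the `e^{±iθ}`-eigenspace of `U`:
Hermitian, idempotent, with range the `e^{±iθ}`-eigenspace. -/
theorem eigenprojection_of_bipartite_walk
    (m a b : ℕ) (hm : 0 < m) (ha : 0 < a) (hb : 0 < b)
    (P₀ : Matrix (Fin m) (Fin a) ℝ) (P₁ : Matrix (Fin m) (Fin b) ℝ)
    (hP₀ : P₀ᵀ * P₀ = 1) (hP₁ : P₁ᵀ * P₁ = 1)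
    (P Q : Matrix (Fin m) (Fin m) ℝ) (C : Matrix (Fin b) (Fin a) ℝ)
    (hP : P = P₀ * P₀ᵀ) (hQ : Q = P₁ * P₁ᵀ) (hC : C = P₁ᵀ * P₀)
    (U : Matrix (Fin m) (Fin m) ℂ)
    (hU : U = (((2 : ℝ) • P - 1) * ((2 : ℝ) • Q - 1)).map Complex.ofReal)
    (μ : ℝ) (hμmem : μ ∈ Set.Ioo (0 : ℝ) 1)
    (hμeig : ∃ y : Fin b → ℝ, y ≠ 0 ∧ (C * Cᵀ).mulVec y = μ • y)
    (θ : ℝ) (hθmem : θ ∈ Set.Ioo (0 : ℝ) Real.pi)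
    (hθ : Real.cos θ = 2 * μ - 1)
    -- `Fμ` is the orthogonal projection onto the `μ`-eigenspace of `ĈĈᵀ`
    (Fμ : Matrix (Fin b) (Fin b) ℝ)
    (hFμsymm : Fμᵀ = Fμ) (hFμidem : Fμ * Fμ = Fμ)
    (hFμrange : LinearMap.range Fμ.mulVecLin =
      LinearMap.ker ((C * Cᵀ).mulVecLin - μ • LinearMap.id))
    (W : Matrix (Fin m) (Fin m) ℝ) (hW : W = P₁ * Fμ * P₁ᵀ)
    (Eplus Eminus : Matrix (Fin m) (Fin m) ℂ)
    (hEp : Eplus = (((Real.sin θ) ^ 2 : ℝ) : ℂ)⁻¹ •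
      (((Real.cos θ + 1 : ℝ) : ℂ) • (W.map Complex.ofReal) -
        (Complex.exp (θ * Complex.I) + 1) •
          ((P.map Complex.ofReal) * (W.map Complex.ofReal)) -
        (Complex.exp (-(θ * Complex.I)) + 1) •
          ((W.map Complex.ofReal) * (P.map Complex.ofReal)) +
        (2 : ℂ) • ((P.map Complex.ofReal) * (W.map Complex.ofReal) *
          (P.map Complex.ofReal))))
    (hEm : Eminus = (((Real.sin θ) ^ 2 : ℝ) : ℂ)⁻¹ •
      (((Real.cos θ + 1 : ℝ) : ℂ) • (W.map Complex.ofReal) -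
        (Complex.exp (-(θ * Complex.I)) + 1) •
          ((P.map Complex.ofReal) * (W.map Complex.ofReal)) -
        (Complex.exp (θ * Complex.I) + 1) •
          ((W.map Complex.ofReal) * (P.map Complex.ofReal)) +
        (2 : ℂ) • ((P.map Complex.ofReal) * (W.map Complex.ofReal) *
          (P.map Complex.ofReal)))) :
    (Eplus.IsHermitian ∧ Eplus * Eplus = Eplus ∧
      LinearMap.range Eplus.mulVecLin =
        LinearMap.ker (U.mulVecLin - Complex.exp (θ * Complex.I) • LinearMap.id)) ∧
    (Eminus.IsHermitian ∧ Eminus * Eminus = Eminus ∧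
      LinearMap.range Eminus.mulVecLin =
        LinearMap.ker (U.mulVecLin - Complex.exp (-(θ * Complex.I)) • LinearMap.id)) := by
  have hQW : Q * W = W := by
    rw [hQ, hW, show P₁ * P₁ᵀ * (P₁ * Fμ * P₁ᵀ) = P₁ * (P₁ᵀ * P₁) * Fμ * P₁ᵀ by
      simp only [Matrix.mul_assoc], hP₁, Matrix.mul_one]
  have hPP : P * P = P := by
    rw [hP, show P₀ * P₀ᵀ * (P₀ * P₀ᵀ) = P₀ * (P₀ᵀ * P₀) * P₀ᵀ by
      simp only [Matrix.mul_assoc], hP₀, Matrix.mul_one]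
  have hQQ : Q * Q = Q := by
    rw [hQ, show P₁ * P₁ᵀ * (P₁ * P₁ᵀ) = P₁ * (P₁ᵀ * P₁) * P₁ᵀ by
      simp only [Matrix.mul_assoc], hP₁, Matrix.mul_one]
  have hPt : Pᵀ = P := by simp [hP]
  have hQt : Qᵀ = Q := by simp [hQ]
  have hWt : Wᵀ = W := by simp [hW, hFμsymm, Matrix.mul_assoc]
  have hWQ : W * Q = W := by
    simpa [hQt, hWt] using congrArg transpose hQW
  have hCF : C * Cᵀ * Fμ = μ • Fμ := by
    refine ext_of_mulVec_single fun i => ?_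
    have h : Fμ.mulVecLin (Pi.single i 1) ∈
        LinearMap.ker ((C * Cᵀ).mulVecLin - μ • LinearMap.id) :=
      hFμrange ▸ LinearMap.mem_range_self _ _
    rw [LinearMap.mem_ker, LinearMap.sub_apply, sub_eq_zero] at h
    rw [← mulVec_mulVec, smul_mulVec]
    exact h
  have hF : ∀ y, (C * Cᵀ).mulVec y = μ • y → Fμ.mulVec y = y := by
    intro y hy
    have h : y ∈ LinearMap.range Fμ.mulVecLin := by
      rw [hFμrange, LinearMap.mem_ker, LinearMap.sub_apply, sub_eq_zero]
      exact hy
    obtain ⟨x, rfl⟩ := h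
    rw [mulVecLin_apply, mulVec_mulVec, hFμidem]
  have hQPW : Q * (P * W) = μ • W := by
    rw [hQ, hP, hW, show P₁ * P₁ᵀ * (P₀ * P₀ᵀ * (P₁ * Fμ * P₁ᵀ)) =
      P₁ * (C * Cᵀ * Fμ) * P₁ᵀ by simp [hC, Matrix.mul_assoc], hCF]
    simp
  have hWz : ∀ x, (Q * P * Q).mulVec x = (μ • Q).mulVec x → W.mulVec x = Q.mulVec x := by
    intro x hx
    have h1 : P₁ᵀ * (Q * P * Q) = C * Cᵀ * P₁ᵀ := by
      rw [hQ, hP, hC, show P₁ᵀ * (P₁ * P₁ᵀ * (P₀ * P₀ᵀ) * (P₁ * P₁ᵀ)) =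
        P₁ᵀ * P₁ * (P₁ᵀ * (P₀ * P₀ᵀ) * (P₁ * P₁ᵀ)) by simp only [Matrix.mul_assoc], hP₁]
      simp [Matrix.mul_assoc]
    have h2 : P₁ᵀ * (μ • Q) = μ • P₁ᵀ := by
      rw [hQ, Matrix.mul_smul, ← Matrix.mul_assoc, hP₁, Matrix.one_mul]
    have h := congrArg P₁ᵀ.mulVec hx
    rw [mulVec_mulVec, mulVec_mulVec, h1, h2, ← mulVec_mulVec, smul_mulVec] at h
    rw [hW, hQ, ← mulVec_mulVec, ← mulVec_mulVec, hF _ h, mulVec_mulVec]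
  have hsin : Real.sin θ ^ 2 = 4 * μ * (1 - μ) := by
    rw [Real.sin_sq, hθ]
    ring
  have hsin0 : Real.sin θ ^ 2 ≠ 0 :=
    pow_ne_zero _ (Real.sin_pos_of_mem_Ioo hθmem).ne'
  have hmul (A B : Matrix (Fin m) (Fin m) ℝ) :
      (A * B).map Complex.ofReal = A.map Complex.ofReal * B.map Complex.ofReal :=
    Matrix.map_mul (f := Complex.ofRealHom)
  have hsmul (r : ℝ) (A : Matrix (Fin m) (Fin m) ℝ) :
      (r • A).map Complex.ofReal = (r : ℂ) • A.map Complex.ofReal := by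
    ext
    simp
  have hHerm (A : Matrix (Fin m) (Fin m) ℝ) (hA : Aᵀ = A) :
      (A.map Complex.ofReal).IsHermitian := by
    ext i j
    simpa using congrFun (congrFun hA i) j
  have key (l l' : ℂ) (hl : star l = l') (hll : l * l' = 1)
      (hsum : l + l' = 4 * (μ : ℂ) - 2) (E : Matrix (Fin m) (Fin m) ℂ)
      (hE : E = (((Real.sin θ) ^ 2 : ℝ) : ℂ)⁻¹ •
        (((Real.cos θ + 1 : ℝ) : ℂ) • (W.map Complex.ofReal) -
          (l + 1) • ((P.map Complex.ofReal) * (W.map Complex.ofReal)) -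
          (l' + 1) • ((W.map Complex.ofReal) * (P.map Complex.ofReal)) +
          (2 : ℂ) • ((P.map Complex.ofReal) * (W.map Complex.ofReal) *
            (P.map Complex.ofReal)))) :=
    eigenprojection_of_product_of_reflections (Q := Q.map Complex.ofReal) (U := U) (E := E)
      (μ := μ) (s := (Real.sin θ ^ 2 : ℝ)) (hHerm P hPt) (hHerm W hWt)
      (by rw [← hmul, hPP]) (by rw [← hmul, hQQ]) (by rw [← hmul, hQW]) (by rw [← hmul, hWQ])
      (by rw [← hmul, ← hmul, hQPW, hsmul])
      (fun z hz => map_ofReal_mulVec_eq_of_real hWz z (by rwa [hmul, hmul, hsmul]))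
      (by
        rw [hU, hmul, Matrix.map_sub _ Complex.ofReal_sub, Matrix.map_sub _ Complex.ofReal_sub,
          hsmul, hsmul, Matrix.map_one _ Complex.ofReal_zero Complex.ofReal_one]
        norm_num)
      (Complex.conj_ofReal μ) hl hll hsum (by rw [hsin]; push_cast; ring)
      (Complex.ofReal_ne_zero.mpr hsin0)
      (by rw [hE, hθ]; push_cast; ring_nf)
  have hconj : star (Complex.exp (θ * Complex.I)) = Complex.exp (-(θ * Complex.I)) := by
    simp [← Complex.exp_conj]
  have hexp : Complex.exp (θ * Complex.I) * Complex.exp (-(θ * Complex.I)) = 1 := by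
    rw [← Complex.exp_add, add_neg_cancel, Complex.exp_zero]
  have hsum : Complex.exp (θ * Complex.I) + Complex.exp (-(θ * Complex.I)) =
      4 * (μ : ℂ) - 2 := by
    rw [← neg_mul, ← Complex.two_cos, ← Complex.ofReal_cos, hθ]
    push_cast
    ring
  exact ⟨key _ _ hconj hexp hsum _ hEp,
    key _ _ (by rw [← hconj, star_star]) (by rw [mul_comm, hexp]) (by rw [add_comm, hsum]) _ hEm⟩
end

section
/- Let G be a finite connected simple graph with at least one edge that is bipartite with parts X and Y (every edge has one end in X and one in Y). Index real matrices by the edge set of G, and define: P with entries P_{e,f} = 1/deg(x) if e and f have a common end x ∈ X and P_{e,f} = 0 otherwise; Q with entries Q_{e,f} = 1/deg(y) if e and f have a common end y ∈ Y and Q_{e,f} = 0 otherwise. Let U = (2P − I)(2Q − I). Then U is a permutation matrix (every entry is 0 or 1, with exactly one 1 in each row and exactly one 1 in each column) if and only if every vertex of G has degree 1 or 2. -/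
open Matrix

namespace BipartiteWalk

/-- The projection onto the edge functions constant on the stars of the vertices in `S`. -/
noncomputable def starProj {V : Type} [Fintype V] [DecidableEq V] (G : SimpleGraph V)
    [DecidableRel G.Adj] (S : Set V) [DecidablePred (· ∈ S)] : Matrix G.edgeSet G.edgeSet ℝ :=
  Matrix.of fun e f => ∑ x : V, if x ∈ S ∧ x ∈ (e : Sym2 V) ∧ x ∈ (f : Sym2 V)
    then ((G.degree x : ℝ))⁻¹ else 0

theorem exists_mem_end {V : Type} {G : SimpleGraph V} {S : Set V}
    (hS : ∀ u v, G.Adj u v → (u ∈ S ↔ v ∉ S))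
    (e : G.edgeSet) :
    ∃ x ∈ S, x ∈ (e : Sym2 V) := by
  obtain ⟨e, he⟩ := e
  induction e with
  | _ u v =>
    by_cases hu : u ∈ S
    · exact ⟨u, hu, by simp⟩
    · refine ⟨v, ?_, by simp⟩
      by_contra hv
      exact hu ((hS u v he).2 hv)

section

variable {V : Type} [Fintype V] [DecidableEq V] {G : SimpleGraph V} [DecidableRel G.Adj]
  {S : Set V} [DecidablePred (· ∈ S)]

theorem card_edges_mem_eq_degree (x : V) :
    (Finset.univ.filter fun f : G.edgeSet => x ∈ (f : Sym2 V)).card = G.degree x := by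
  rw [← G.card_incidenceFinset_eq_degree x]
  refine Finset.card_bij (fun f _ => (f : Sym2 V)) ?_ ?_ ?_
  · intro f hf
    simp only [Finset.mem_filter, Finset.mem_univ, true_and] at hf
    rw [SimpleGraph.mem_incidenceFinset]
    exact ⟨f.2, hf⟩
  · intro f _ g _ h
    exact Subtype.ext h
  · intro f hf
    rw [SimpleGraph.mem_incidenceFinset] at hf
    exact ⟨⟨f, hf.1⟩, by simpa using hf.2, rfl⟩

theorem starProj_apply_of_mem (hS : ∀ u v, G.Adj u v → (u ∈ S ↔ v ∉ S)) {e : G.edgeSet} {x : V}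
    (hxS : x ∈ S) (hxe : x ∈ (e : Sym2 V)) (f : G.edgeSet) :
    starProj G S e f = if x ∈ (f : Sym2 V) then ((G.degree x : ℝ))⁻¹ else 0 := by
  unfold starProj
  rw [Matrix.of_apply, Finset.sum_eq_single x]
  · simp [hxS, hxe]
  · intro b _ hb
    refine if_neg ?_
    rintro ⟨hbS, hbe, -⟩
    have he := (Sym2.mem_and_mem_iff hb).1 ⟨hbe, hxe⟩
    have hadj : G.Adj b x := by
      rw [← SimpleGraph.mem_edgeSet, ← he]
      exact e.2
    exact (hS b x hadj).1 hbS hxS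
  · simp

theorem starProj_transpose : (starProj G S)ᵀ = starProj G S := by
  ext e f
  simp only [starProj, Matrix.transpose_apply, Matrix.of_apply]
  refine Finset.sum_congr rfl fun x _ => ?_
  congr 1
  simp only [and_comm]

theorem degree_pos_of_mem {e : G.edgeSet} {x : V} (hxe : x ∈ (e : Sym2 V)) : 0 < G.degree x := by
  rw [← card_edges_mem_eq_degree, Finset.card_pos]
  exact ⟨e, by simpa using hxe⟩

theorem starProj_mulVec_star (hS : ∀ u v, G.Adj u v → (u ∈ S ↔ v ∉ S)) {y : V} (hy : y ∈ S) :
    starProj G S *ᵥ (fun f : G.edgeSet => if y ∈ (f : Sym2 V) then 1 else 0) =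
      fun f : G.edgeSet => if y ∈ (f : Sym2 V) then 1 else 0 := by
  ext e
  simp only [Matrix.mulVec, dotProduct, mul_ite, mul_one, mul_zero]
  split_ifs with hye
  · have hpos : (G.degree y : ℝ) ≠ 0 := by exact_mod_cast (degree_pos_of_mem hye).ne'
    simp only [starProj_apply_of_mem hS hy hye]
    rw [← Finset.sum_filter, Finset.sum_congr rfl (g := fun _ => ((G.degree y : ℝ))⁻¹)]
    · rw [Finset.sum_const, card_edges_mem_eq_degree, nsmul_eq_mul, mul_inv_cancel₀ hpos]
    · intro f hf
      simp_all
  · obtain ⟨x, hxS, hxe⟩ := exists_mem_end hS e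
    refine Finset.sum_eq_zero fun f _ => ?_
    split_ifs with hyf
    · rw [← starProj_transpose, Matrix.transpose_apply, starProj_apply_of_mem hS hy hyf,
        if_neg hye]
    · rfl

theorem starProj_row_sum (hS : ∀ u v, G.Adj u v → (u ∈ S ↔ v ∉ S)) (e : G.edgeSet) :
    ∑ f, starProj G S e f = 1 := by
  obtain ⟨x, hxS, hxe⟩ := exists_mem_end hS e
  have hpos : (G.degree x : ℝ) ≠ 0 := by exact_mod_cast (degree_pos_of_mem hxe).ne'
  simp only [starProj_apply_of_mem hS hxS hxe]
  rw [← Finset.sum_filter, Finset.sum_const, card_edges_mem_eq_degree, nsmul_eq_mul,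
    mul_inv_cancel₀ hpos]

/-- If the transition matrix of the bipartite walk has all entries in `{0, 1}`, then the vertices in
`S` have degree at most two: summing a row over the star of a `T`-vertex gives an integer, while it
equals `2 / deg x` when the row is that of another edge at a common neighbour `x ∈ S`. -/
theorem degree_le_two_of_entries {T : Set V} [DecidablePred (· ∈ T)]
    (hS : ∀ u v, G.Adj u v → (u ∈ S ↔ v ∉ S)) (hT : ∀ u v, G.Adj u v → (u ∈ T ↔ v ∉ T))
    (hST : ∀ v, v ∈ T ↔ v ∉ S)
    (hU : ∀ e f, (((2 : ℝ) • starProj G S - 1) * ((2 : ℝ) • starProj G T - 1)) e f = 0 ∨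
      (((2 : ℝ) • starProj G S - 1) * ((2 : ℝ) • starProj G T - 1)) e f = 1)
    {x : V} (hx : x ∈ S) : G.degree x ≤ 2 := by
  by_contra! hdeg
  obtain ⟨e, he, f, hf, hef⟩ := Finset.one_lt_card.1
    (show 1 < (Finset.univ.filter fun f : G.edgeSet => x ∈ (f : Sym2 V)).card by
      rw [card_edges_mem_eq_degree]; omega)
  simp only [Finset.mem_filter, Finset.mem_univ, true_and] at he hf
  obtain ⟨y, hyT, hyf⟩ := exists_mem_end hT f
  have hxy : x ≠ y := by
    rintro rfl
    exact (hST x).1 hyT hx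
  have huniq : ∀ g : G.edgeSet, x ∈ (g : Sym2 V) → y ∈ (g : Sym2 V) → g = f := by
    intro g hxg hyg
    apply Subtype.ext
    rw [(Sym2.mem_and_mem_iff hxy).1 ⟨hxg, hyg⟩, (Sym2.mem_and_mem_iff hxy).1 ⟨hf, hyf⟩]
  have hye : y ∉ (e : Sym2 V) := fun hye => hef (huniq e he hye)
  set w : G.edgeSet → ℝ := fun f => if y ∈ (f : Sym2 V) then 1 else 0 with hw
  have hB : ((2 : ℝ) • starProj G T - 1) *ᵥ w = w := by
    rw [Matrix.sub_mulVec, Matrix.smul_mulVec, starProj_mulVec_star hT hyT, Matrix.one_mulVec]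
    ext g
    simp only [Pi.sub_apply, Pi.smul_apply, smul_eq_mul]
    ring
  have hA : (((2 : ℝ) • starProj G S - 1) *ᵥ w) e = 2 * ((G.degree x : ℝ))⁻¹ := by
    rw [Matrix.sub_mulVec, Matrix.smul_mulVec, Matrix.one_mulVec]
    have hwe : w e = 0 := if_neg hye
    have hsum : (starProj G S *ᵥ w) e = ((G.degree x : ℝ))⁻¹ := by
      simp only [Matrix.mulVec, dotProduct]
      rw [Finset.sum_eq_single f]
      · rw [starProj_apply_of_mem hS hx he, if_pos hf]
        simp [hw, hyf]
      · intro g _ hg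
        rw [starProj_apply_of_mem hS hx he]
        by_cases hxg : x ∈ (g : Sym2 V)
        · have hyg : y ∉ (g : Sym2 V) := fun hyg => hg (huniq g hxg hyg)
          simp [hw, hyg]
        · simp [hxg]
      · simp
    simp only [Pi.sub_apply, Pi.smul_apply, smul_eq_mul, hwe, hsum, sub_zero]
  set U := ((2 : ℝ) • starProj G S - 1) * ((2 : ℝ) • starProj G T - 1) with hUdef
  have hUw : (U *ᵥ w) e = 2 * ((G.degree x : ℝ))⁻¹ := by
    rw [hUdef, ← Matrix.mulVec_mulVec, hB, hA]
  have hint : ∃ n : ℕ, (U *ᵥ w) e = n := by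
    have hterm : ∀ g, ∃ n : ℕ, U e g * w g = n := by
      intro g
      rcases hU e g with h | h
      · exact ⟨0, by simp [h]⟩
      · by_cases hyg : y ∈ (g : Sym2 V)
        · exact ⟨1, by simp [h, hw, hyg]⟩
        · exact ⟨0, by simp [hw, hyg]⟩
    choose n hn using hterm
    refine ⟨∑ g, n g, ?_⟩
    simp only [Matrix.mulVec, dotProduct, hn, Nat.cast_sum]
  obtain ⟨n, hn⟩ := hint
  have hd : (0 : ℝ) < G.degree x := by exact_mod_cast (by omega : 0 < G.degree x)
  have hmul : (n : ℝ) * G.degree x = 2 := by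
    rw [← hn, hUw, mul_assoc, inv_mul_cancel₀ hd.ne', mul_one]
  have hnat : n * G.degree x = 2 := by exact_mod_cast hmul
  exact absurd (Nat.le_of_dvd two_pos ⟨n, by rw [mul_comm, hnat]⟩) (by omega)

end

/-- Square matrices with natural-number entries all of whose row and column sums are `1`. -/
structure IsNatDoublyStochastic {ι : Type} [Fintype ι] (M : Matrix ι ι ℝ) : Prop where
  nat_entry : ∀ i j, ∃ n : ℕ, M i j = n
  row_sum : ∀ i, ∑ j, M i j = 1
  col_sum : ∀ j, ∑ i, M i j = 1

theorem IsNatDoublyStochastic.mul {ι : Type} [Fintype ι] {M N : Matrix ι ι ℝ}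
    (hM : IsNatDoublyStochastic M) (hN : IsNatDoublyStochastic N) :
    IsNatDoublyStochastic (M * N) where
  nat_entry i j := by
    choose m hm using hM.nat_entry
    choose n hn using hN.nat_entry
    exact ⟨∑ k, m i k * n k j, by simp [Matrix.mul_apply, hm, hn]⟩
  row_sum i := by
    simp only [Matrix.mul_apply]
    rw [Finset.sum_comm]
    simp only [← Finset.mul_sum, hN.row_sum, mul_one, hM.row_sum]
  col_sum j := by
    simp only [Matrix.mul_apply]
    rw [Finset.sum_comm]
    simp only [← Finset.sum_mul, hM.col_sum, one_mul, hN.col_sum]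

theorem zero_or_one_and_existsUnique_of_sum_eq_one {ι : Type} [Fintype ι] {a : ι → ℝ}
    (ha : ∀ i, ∃ n : ℕ, a i = n) (hsum : ∑ i, a i = 1) :
    (∀ i, a i = 0 ∨ a i = 1) ∧ ∃! i, a i = 1 := by
  classical
  choose n hn using ha
  have hnsum : ∑ i, n i = 1 := by
    have : ((∑ i, n i : ℕ) : ℝ) = 1 := by simpa [hn] using hsum
    exact_mod_cast this
  obtain ⟨i, hi⟩ : ∃ i, n i ≠ 0 := by
    by_contra! h
    simp [h] at hnsum
  have hsplit := Finset.add_sum_erase Finset.univ n (Finset.mem_univ i)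
  have hrest : ∑ j ∈ Finset.univ.erase i, n j = 0 := by omega
  have hzero : ∀ j, j ≠ i → n j = 0 := fun j hj =>
    Finset.sum_eq_zero_iff.1 hrest j (Finset.mem_erase.2 ⟨hj, Finset.mem_univ j⟩)
  have hone : n i = 1 := by omega
  refine ⟨fun j => ?_, i, by simp [hn, hone], fun j hj => ?_⟩
  · by_cases hj : j = i
    · right
      simp [hn, hj, hone]
    · left
      simp [hn, hzero j hj]
  · by_contra hji
    simp [hn, hzero j hji] at hj

theorem isNatDoublyStochastic_reflection {V : Type} [Fintype V] [DecidableEq V]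
    {G : SimpleGraph V} [DecidableRel G.Adj] {S : Set V} [DecidablePred (· ∈ S)]
    (hS : ∀ u v, G.Adj u v → (u ∈ S ↔ v ∉ S)) (hdeg : ∀ v, G.degree v = 1 ∨ G.degree v = 2) :
    IsNatDoublyStochastic ((2 : ℝ) • starProj G S - 1) := by
  have hrow : ∀ e, ∑ f, ((2 : ℝ) • starProj G S - 1) e f = 1 := by
    intro e
    simp only [Matrix.sub_apply, Matrix.smul_apply, smul_eq_mul, Finset.sum_sub_distrib,
      ← Finset.mul_sum, starProj_row_sum hS]
    simp [Matrix.one_apply]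
    norm_num
  refine ⟨fun e f => ?_, hrow, fun f => ?_⟩
  · obtain ⟨x, hxS, hxe⟩ := exists_mem_end hS e
    rw [Matrix.sub_apply, Matrix.smul_apply, starProj_apply_of_mem hS hxS hxe, smul_eq_mul]
    by_cases hef : e = f
    · subst hef
      rcases hdeg x with h | h
      · exact ⟨1, by norm_num [h, hxe]⟩
      · exact ⟨0, by norm_num [h, hxe]⟩
    · by_cases hxf : x ∈ (f : Sym2 V)
      · have hlt : 1 < G.degree x := by
          rw [← card_edges_mem_eq_degree, Finset.one_lt_card]
          exact ⟨e, by simpa using hxe, f, by simpa using hxf, hef⟩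
        have h : G.degree x = 2 := (hdeg x).resolve_left hlt.ne'
        exact ⟨1, by simp [h, hxf, hef]⟩
      · exact ⟨0, by simp [hxf, hef]⟩
  · rw [← hrow f]
    refine Finset.sum_congr rfl fun e _ => ?_
    rw [← Matrix.transpose_apply ((2 : ℝ) • starProj G S - 1) f e, Matrix.transpose_sub,
      Matrix.transpose_smul, starProj_transpose, Matrix.transpose_one]

end BipartiteWalk

/-- For a finite connected bipartite graph `G` with parts `X`
and its complement, with `P`, `Q` the projection matrices on `ℝ^{E(G)}` with
entries `1/deg(x)` for edges sharing the common end `x` in `X` (resp. not in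
`X`), the transition matrix `U = (2P − I)(2Q − I)` of the bipartite walk on `G`
is a permutation matrix if and only if every vertex of `G` has degree 1 or 2. -/
theorem bipartite_walk_permutation_iff_max_degree_two
    (V : Type) [Fintype V] [DecidableEq V]
    (G : SimpleGraph V) [DecidableRel G.Adj]
    (hconn : G.Connected) (hne : G.edgeSet.Nonempty)
    (X : Set V) [DecidablePred (· ∈ X)]
    (hbip : ∀ u v, G.Adj u v → (u ∈ X ↔ v ∉ X))
    (P Q U : Matrix G.edgeSet G.edgeSet ℝ)
    (hPdef : ∀ e f : G.edgeSet, P e f =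
      ∑ x : V, if x ∈ X ∧ x ∈ (e : Sym2 V) ∧ x ∈ (f : Sym2 V)
        then ((G.degree x : ℝ))⁻¹ else 0)
    (hQdef : ∀ e f : G.edgeSet, Q e f =
      ∑ x : V, if x ∉ X ∧ x ∈ (e : Sym2 V) ∧ x ∈ (f : Sym2 V)
        then ((G.degree x : ℝ))⁻¹ else 0)
    (hU : U = ((2 : ℝ) • P - 1) * ((2 : ℝ) • Q - 1)) :
    ((∀ e f, U e f = 0 ∨ U e f = 1) ∧
      (∀ e, ∃! f, U e f = 1) ∧ (∀ f, ∃! e, U e f = 1)) ↔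
    (∀ v : V, G.degree v = 1 ∨ G.degree v = 2) := by
  classical
  have hbip' : ∀ u v, G.Adj u v → (u ∈ Xᶜ ↔ v ∉ Xᶜ) := by
    intro u v huv
    have := hbip u v huv
    simp only [Set.mem_compl_iff]
    tauto
  obtain rfl : P = BipartiteWalk.starProj G X := by
    ext e f
    rw [hPdef]
    simp [BipartiteWalk.starProj]
  obtain rfl : Q = BipartiteWalk.starProj G Xᶜ := by
    ext e f
    rw [hQdef]
    simp [BipartiteWalk.starProj]
  constructor
  · rintro ⟨hentry, -, -⟩ v
    have hle : G.degree v ≤ 2 := by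
      by_cases hv : v ∈ X
      · refine BipartiteWalk.degree_le_two_of_entries hbip hbip' (fun v => Iff.rfl) ?_ hv
        rw [← hU]
        exact hentry
      · refine BipartiteWalk.degree_le_two_of_entries hbip' hbip (fun v => by simp) ?_
          (show v ∈ Xᶜ from hv)
        have hUt : Uᵀ = ((2 : ℝ) • BipartiteWalk.starProj G Xᶜ - 1) *
            ((2 : ℝ) • BipartiteWalk.starProj G X - 1) := by
          rw [hU, Matrix.transpose_mul, Matrix.transpose_sub, Matrix.transpose_sub,
            Matrix.transpose_smul, Matrix.transpose_smul, BipartiteWalk.starProj_transpose,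
            BipartiteWalk.starProj_transpose, Matrix.transpose_one]
        rw [← hUt]
        exact fun e f => hentry f e
    have : Nontrivial V := by
      obtain ⟨e, he⟩ := hne
      induction e with
      | _ a b => exact ⟨a, b, G.ne_of_adj he⟩
    have hpos := hconn.preconnected.degree_pos_of_nontrivial v
    omega
  · intro hdeg
    have h := (BipartiteWalk.isNatDoublyStochastic_reflection hbip hdeg).mul
      (BipartiteWalk.isNatDoublyStochastic_reflection hbip' hdeg)
    rw [← hU] at h
    have hrow := fun e =>
      BipartiteWalk.zero_or_one_and_existsUnique_of_sum_eq_one (h.nat_entry e) (h.row_sum e)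
    have hcol := fun f => BipartiteWalk.zero_or_one_and_existsUnique_of_sum_eq_one
      (fun e => h.nat_entry e f) (h.col_sum f)
    exact ⟨fun e => (hrow e).1, fun e => (hrow e).2, fun f => (hcol f).2⟩
end

section
/- For every integer n ≥ 2, the permutation σₙ of {0, 1, …, n−2} has order exactly n−1 and acts transitively: for all i, j ∈ {0, …, n−2} there exists a natural number k with σₙ^k(i) = j; in particular σₙ^{n−1} is the identity, so σₙ is a single (n−1)-cycle (for n ≥ 3). -/
/-- `τ` swaps `2j−1` and `2j` for each `j ≥ 1` with `2j ≤ n−2`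
(as a function on `{0, …, n−2}`). -/
def pathTau (n : ℕ) (k : ℕ) : ℕ :=
  if k % 2 = 1 then (if k + 1 ≤ n - 2 then k + 1 else k)
  else if k = 0 then 0 else k - 1

/-- `ρ` swaps `2j` and `2j+1` for each `j ≥ 0` with `2j+1 ≤ n−2`
(as a function on `{0, …, n−2}`). -/
def pathRho (n : ℕ) (k : ℕ) : ℕ :=
  if k % 2 = 0 then (if k + 1 ≤ n - 2 then k + 1 else k) else k - 1

/-- `σₙ = ρ ∘ τ`, the permutation of `{0, …, n−2}` underlying the transition
matrix of the bipartite walk on the path `Pₙ`. -/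
def pathSigma (n : ℕ) (k : ℕ) : ℕ := pathRho n (pathTau n k)

/-- The orbit of `0` under `σₙ`: it climbs through the odd numbers, then descends through the
even ones, and is back at `0` after `n - 1` steps. -/
def pathOrbit (n t : ℕ) : ℕ :=
  if t = 0 then 0 else if 2 * t ≤ n - 1 then 2 * t - 1 else 2 * (n - 1 - t)

theorem pathSigma_pathOrbit {n t : ℕ} (ht : t < n - 1) :
    pathSigma n (pathOrbit n t) = pathOrbit n (t + 1) := by
  unfold pathSigma pathRho pathTau pathOrbit
  grind

theorem exists_pathOrbit_eq {n i : ℕ} (hi : i < n - 1) :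
    ∃ t < n - 1, pathOrbit n t = i := by
  unfold pathOrbit
  obtain h | h := Nat.mod_two_eq_zero_or_one i
  · by_cases h0 : i = 0
    · exact ⟨0, by grind⟩
    · exact ⟨n - 1 - i / 2, by grind⟩
  · exact ⟨(i + 1) / 2, by grind⟩

theorem pathOrbit_ne_zero {n t : ℕ} (h0 : 0 < t) (ht : t < n - 1) : pathOrbit n t ≠ 0 := by
  unfold pathOrbit
  grind

theorem pathOrbit_self (n : ℕ) : pathOrbit n (n - 1) = 0 := by
  unfold pathOrbit
  grind

/-- For every `n ≥ 2`, the permutation `σₙ` of `{0, …, n−2}`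
has order exactly `n−1` and acts transitively; in particular it is a single
`(n−1)`-cycle. -/
theorem pathSigma_order_and_transitive (n : ℕ) (hn : 2 ≤ n)
    (σ : Equiv.Perm (Fin (n - 1)))
    (hσ : ∀ i : Fin (n - 1), ((σ i : ℕ)) = pathSigma n (i : ℕ)) :
    orderOf σ = n - 1 ∧ ∀ i j : Fin (n - 1), ∃ k : ℕ, (σ ^ k) i = j := by
  have hpos : 0 < n - 1 := by omega
  have orbit : ∀ t ≤ n - 1, ((σ ^ t) ⟨0, hpos⟩ : ℕ) = pathOrbit n t := by
    intro t
    induction t with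
    | zero => simp [pathOrbit]
    | succ t ih =>
      intro ht
      rw [pow_succ', Equiv.Perm.mul_apply, hσ, ih (by omega), pathSigma_pathOrbit ht]
  have reach : ∀ i, ∃ t < n - 1, (σ ^ t) ⟨0, hpos⟩ = i := by
    intro i
    obtain ⟨t, ht, h⟩ := exists_pathOrbit_eq i.isLt
    exact ⟨t, ht, Fin.ext ((orbit t ht.le).trans h)⟩
  have period : (σ ^ (n - 1)) ⟨0, hpos⟩ = ⟨0, hpos⟩ :=
    Fin.ext ((orbit _ le_rfl).trans (pathOrbit_self n))
  refine ⟨(orderOf_eq_iff hpos).2 ⟨?_, ?_⟩, ?_⟩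
  · ext1 i
    obtain ⟨t, -, rfl⟩ := reach i
    rw [← Equiv.Perm.mul_apply, ← pow_add, add_comm, pow_add, Equiv.Perm.mul_apply, period,
      Equiv.Perm.one_apply]
  · intro t ht h0 h
    apply pathOrbit_ne_zero h0 ht
    rw [← orbit t ht.le, h, Equiv.Perm.one_apply]
  · intro i j
    obtain ⟨a, ha, rfl⟩ := reach i
    obtain ⟨b, -, rfl⟩ := reach j
    refine ⟨b + (n - 1 - a), ?_⟩
    rw [← Equiv.Perm.mul_apply, ← pow_add, add_assoc, Nat.sub_add_cancel ha.le, pow_add,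
      Equiv.Perm.mul_apply, period]
end

section
/- Let n ≥ 4 be even, let k be an integer, and set λ = exp(2πik/(n−1)) ∈ ℂ. Define the vector f ∈ ℂ^{n−1} (coordinates indexed by 0, 1, …, n−2) by f_0 = 1, f_{2j−1} = λ^{−j} and f_{2j} = λ^{j} for 1 ≤ j ≤ (n−2)/2. Then Uₙ f = λ f, i.e., f is an eigenvector of the permutation matrix Uₙ with eigenvalue λ. -/
/-- The transition matrix `Uₙ` of the bipartite walk on the path `Pₙ`:
the `(n−1)×(n−1)` permutation matrix with `(Uₙ)_{i,j} = 1` iff `i = σₙ(j)`. -/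
def pathU (n : ℕ) : Matrix (Fin (n - 1)) (Fin (n - 1)) ℂ :=
  fun i j => if (i : ℕ) = pathSigma n (j : ℕ) then 1 else 0

theorem pathTau_lt {n k : ℕ} (hk : k < n - 1) : pathTau n k < n - 1 := by
  unfold pathTau; split_ifs <;> omega

theorem pathRho_lt {n k : ℕ} (hk : k < n - 1) : pathRho n k < n - 1 := by
  unfold pathRho; split_ifs <;> omega

theorem pathTau_pathTau {n k : ℕ} (hk : k < n - 1) : pathTau n (pathTau n k) = k := by
  unfold pathTau; grind

theorem pathRho_pathRho {n k : ℕ} (hk : k < n - 1) : pathRho n (pathRho n k) = k := by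
  unfold pathRho; grind

theorem eq_pathSigma_iff {n i j : ℕ} (hi : i < n - 1) (hj : j < n - 1) :
    i = pathSigma n j ↔ j = pathTau n (pathRho n i) := by
  unfold pathSigma
  constructor
  · rintro rfl
    rw [pathRho_pathRho (pathTau_lt hj), pathTau_pathTau hj]
  · rintro rfl
    rw [pathTau_pathTau (pathRho_lt hi), pathRho_pathRho hi]

theorem pathU_mulVec_apply (n : ℕ) (f : Fin (n - 1) → ℂ) (i : Fin (n - 1)) :
    (pathU n).mulVec f i = f ⟨pathTau n (pathRho n i), pathTau_lt (pathRho_lt i.isLt)⟩ := by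
  have h (j : Fin (n - 1)) : (i : ℕ) = pathSigma n j ↔
      j = ⟨pathTau n (pathRho n i), pathTau_lt (pathRho_lt i.isLt)⟩ := by
    rw [eq_pathSigma_iff i.isLt j.isLt, Fin.ext_iff]
  simp [Matrix.mulVec, dotProduct, pathU, h]

/-- For even `n ≥ 4`, an integer `k`, and
`λ = exp(2πik/(n−1))`, the vector `f` with `f₀ = 1`, `f_{2j−1} = λ^{−j}`,
`f_{2j} = λ^{j}` (for `1 ≤ j ≤ (n−2)/2`) is an eigenvector of the permutation
matrix `Uₙ` with eigenvalue `λ`. -/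
theorem pathU_eigenvector (n : ℕ) (hn : 4 ≤ n) (heven : Even n) (k : ℤ)
    (lam : ℂ)
    (hlam : lam = Complex.exp (2 * Real.pi * Complex.I * (k : ℂ) / ((n : ℂ) - 1)))
    (f : Fin (n - 1) → ℂ)
    (hf0 : ∀ i : Fin (n - 1), (i : ℕ) = 0 → f i = 1)
    (hfodd : ∀ i : Fin (n - 1), ∀ j : ℕ, 1 ≤ j → (i : ℕ) = 2 * j - 1 →
      f i = lam ^ (-(j : ℤ)))
    (hfeven : ∀ i : Fin (n - 1), ∀ j : ℕ, 1 ≤ j → (i : ℕ) = 2 * j →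
      f i = lam ^ (j : ℤ)) :
    (pathU n).mulVec f = lam • f := by
  have hlam0 : lam ≠ 0 := hlam ▸ Complex.exp_ne_zero _
  have hroot : lam ^ ((n : ℤ) - 1) = 1 := by
    have hn1 : (n : ℂ) - 1 ≠ 0 := by
      rw [sub_ne_zero]
      exact_mod_cast (by omega : n ≠ 1)
    rw [hlam, ← Complex.exp_int_mul, Complex.exp_eq_one_iff]
    refine ⟨k, ?_⟩
    push_cast
    field_simp
  have hodd (i : Fin (n - 1)) (j : ℕ) (hi : (i : ℕ) = 2 * j + 1) :
      f i = lam ^ (-((j : ℤ) + 1)) := by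
    rw [hfodd i (j + 1) (by omega) (by omega)]
    push_cast
    rfl
  have heven' (i : Fin (n - 1)) (j : ℕ) (hi : (i : ℕ) = 2 * j) : f i = lam ^ (j : ℤ) := by
    rcases Nat.eq_zero_or_pos j with rfl | hj
    · simp [hf0 i (by omega)]
    · exact hfeven i j hj hi
  obtain ⟨m, hm⟩ := heven
  ext i
  have hi := i.isLt
  rw [pathU_mulVec_apply, Pi.smul_apply, smul_eq_mul]
  rcases Nat.even_or_odd' (i : ℕ) with ⟨j, hj | hj⟩
  · rw [heven' i j hj, ← zpow_one_add₀ hlam0]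
    by_cases hlast : 2 * j = n - 2
    · have hpre : pathTau n (pathRho n i) = 2 * (j - 1) + 1 := by
        unfold pathTau pathRho; split_ifs <;> omega
      rw [hodd _ (j - 1) hpre]
      have hexp : 1 + (j : ℤ) = -(((j - 1 : ℕ) : ℤ) + 1) + ((n : ℤ) - 1) := by omega
      rw [hexp, zpow_add₀ hlam0, hroot, mul_one]
    · have hpre : pathTau n (pathRho n i) = 2 * (j + 1) := by
        unfold pathTau pathRho; split_ifs <;> omega
      rw [heven' _ (j + 1) hpre]
      congr 1
      push_cast
      ring
  · rw [hodd i j hj, ← zpow_one_add₀ hlam0]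
    rcases Nat.eq_zero_or_pos j with rfl | hj0
    · have hpre : pathTau n (pathRho n i) = 2 * 0 := by
        unfold pathTau pathRho; split_ifs <;> omega
      rw [heven' _ 0 hpre]
      simp
    · have hpre : pathTau n (pathRho n i) = 2 * (j - 1) + 1 := by
        unfold pathTau pathRho; split_ifs <;> omega
      rw [hodd _ (j - 1) hpre]
      congr 1
      omega
end

section
/- For all integers a ≥ 1 and b with 1 ≤ b ≤ 2a, the sum Σ_{k=1}^{a} k·sin(2πkb/(2a+1)) is nonzero. -/
open Finset

/-- Closed form of `∑ k sin (kθ)`, cleared of its denominator `2 - 2 cos θ`. -/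
lemma sum_mul_sin_mul_two_sub_two_cos (m : ℕ) (θ : ℝ) :
    (∑ k ∈ Finset.Icc 1 m, (k : ℝ) * Real.sin (k * θ)) * (2 - 2 * Real.cos θ) =
      (m + 1) * Real.sin (m * θ) - m * Real.sin ((m + 1) * θ) := by
  induction m with
  | zero => simp
  | succ m ih =>
    rw [Finset.sum_Icc_succ_top (by omega), add_mul, ih]
    have h1 : Real.sin (m * θ) = Real.sin ((m + 1) * θ) * Real.cos θ -
        Real.cos ((m + 1) * θ) * Real.sin θ := by
      rw [← Real.sin_sub]; ring_nf
    have h2 : Real.sin ((m + 1 + 1) * θ) = Real.sin ((m + 1) * θ) * Real.cos θ +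
        Real.cos ((m + 1) * θ) * Real.sin θ := by
      rw [← Real.sin_add]; ring_nf
    push_cast
    rw [h1, h2]
    ring

/-- For all integers `a ≥ 1` and `1 ≤ b ≤ 2a`, the sum
`Σ_{k=1}^{a} k·sin(2πkb/(2a+1))` is nonzero. -/
theorem sum_mul_sin_ne_zero (a b : ℕ) (ha : 1 ≤ a) (hb1 : 1 ≤ b)
    (hb2 : b ≤ 2 * a) :
    ∑ k ∈ Finset.Icc 1 a,
      (k : ℝ) * Real.sin (2 * Real.pi * k * b / (2 * a + 1)) ≠ 0 := by
  intro h
  have hn : (2 * a + 1 : ℝ) ≠ 0 := by positivity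
  set θ : ℝ := 2 * Real.pi * b / (2 * a + 1) with hθ
  have hsum : ∑ k ∈ Finset.Icc 1 a, (k : ℝ) * Real.sin (k * θ) = 0 := by
    rw [← h]
    refine Finset.sum_congr rfl fun k _ => ?_
    rw [hθ]
    ring_nf
  have key := sum_mul_sin_mul_two_sub_two_cos a θ
  have hreflect : Real.sin ((a + 1) * θ) = -Real.sin (a * θ) := by
    rw [← Real.sin_nat_mul_two_pi_sub _ b]
    congr 1
    rw [hθ]
    field_simp
    ring
  rw [hsum, hreflect] at key
  have hsin : Real.sin (a * θ) = 0 := by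
    refine (mul_eq_zero.mp ?_).resolve_left hn
    linarith
  obtain ⟨m, hm⟩ := Real.sin_eq_zero_iff.mp hsin
  have hm' : (m : ℝ) * (2 * a + 1) = 2 * a * b := by
    rw [hθ] at hm
    field_simp at hm
    linarith
  have hmZ : m * (2 * a + 1) = 2 * a * b := by exact_mod_cast hm'
  have hdvd : (2 * a + 1 : ℤ) ∣ b := ⟨b - m, by linarith⟩
  have hle := Int.le_of_dvd (by omega) hdvd
  omega
end

section
/- Let n ≥ 2 and let R : Fin n → Fin n → Prop model the adjacency of an (n−1)-regular bipartite graph with parts A = Fin n and B = Fin n: assume that for every a ∈ A there is exactly one b ∈ B with ¬R a b, and for every b ∈ B there is exactly one a ∈ A with ¬R a b; write m(b) for the unique non-neighbour in A of b ∈ B. Let E = {(a,b) : R a b} be the edge set. Then the map F : E → {(u,v) ∈ A × A : u ≠ v} given by F(a,b) = (m(b), a) is a bijection, and for all edges (a,b), (c,d) ∈ E the equivalence (R c b ∧ ¬R a d) ↔ (a = m(d) ∧ c ≠ m(b)) holds, i.e., F is an isomorphism from the H-digraph of the bipartite walk on this graph (which has an arc from edge (a,b) to edge (c,d) exactly when b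 is adjacent to c and a is not adjacent to d) onto the line digraph of the complete graph Kₙ on A (which has an arc from (u,v) to (x,y) exactly when v = x and y ≠ u). -/
/-- Let `R` be the adjacency relation of an `(n−1)`-regular
bipartite graph with parts `A = Fin n` and `B = Fin n`, where each vertex of
one part is adjacent to all but exactly one vertex of the other part, and let
`m b` be the unique non-neighbour in `A` of `b ∈ B`. Then the map
`(a,b) ↦ (m b, a)` from the edge set onto the ordered pairs of distinct
elements of `A` is a bijection, and it transports the arc relation of the
`H`-digraph of the bipartite walk (arc from `(a,b)` to `(c,d)` iff `R c b` and
`¬R a d`) to the arc relation of the line digraph of `Kₙ` (arc from `(u,v)` to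
`(x,y)` iff `v = x` and `y ≠ u`). -/
theorem bipartite_H_digraph_iso_line_digraph
    (n : ℕ) (hn : 2 ≤ n) (R : Fin n → Fin n → Prop)
    (ha : ∀ a : Fin n, ∃! b : Fin n, ¬ R a b)
    (hb : ∀ b : Fin n, ∃! a : Fin n, ¬ R a b)
    (m : Fin n → Fin n) (hm : ∀ b : Fin n, ¬ R (m b) b) :
    -- `F (a,b) = (m b, a)` lands in the vertex set of the line digraph of `Kₙ`
    ((∀ a b : Fin n, R a b → m b ≠ a) ∧
    -- `F` is injective on the edge set
    (∀ a b c d : Fin n, R a b → R c d → (m b, a) = (m d, c) → (a, b) = (c, d)) ∧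
    -- `F` is surjective onto the pairs of distinct vertices of `Kₙ`
    (∀ u v : Fin n, u ≠ v → ∃ a b : Fin n, R a b ∧ m b = u ∧ a = v)) ∧
    -- `F` is an isomorphism of digraphs
    (∀ a b c d : Fin n, R a b → R c d →
      ((R c b ∧ ¬ R a d) ↔ (a = m d ∧ c ≠ m b))) := by
  have not_adj_iff : ∀ a b, ¬ R a b ↔ a = m b := fun a b =>
    ⟨fun h => (hb b).unique h (hm b), fun h => h ▸ hm b⟩
  have adj_iff : ∀ a b, R a b ↔ a ≠ m b := fun a b => by
    rw [← not_iff_not, not_adj_iff, not_not]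
  refine ⟨⟨fun a b h => ((adj_iff a b).1 h).symm, ?_, ?_⟩, ?_⟩
  · intro a b c d _ _ h
    obtain ⟨hbd, hac⟩ := Prod.mk.inj h
    exact Prod.ext hac ((ha (m b)).unique (hm b) (hbd ▸ hm d))
  · intro u v huv
    obtain ⟨b, hub, -⟩ := ha u
    have hmb : u = m b := (not_adj_iff u b).1 hub
    exact ⟨v, b, (adj_iff v b).2 (hmb ▸ huv.symm), hmb.symm, rfl⟩
  · intro a b c d _ _
    rw [adj_iff c b, not_adj_iff a d, and_comm]
end
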